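/- Let R be a commutative ring and m ≥ 3 an integer. If g ∈ SL_m(R[[t]]) is such that its image in SL_m(R((t))) under the canonical inclusion R[[t]] ⊆ R((t)) lies in E_m(R((t))), then g ∈ E_m(R[[t]]). Equivalently, the natural map K1^{SL_m}(R[[t]]) → K1^{SL_m}(R((t))) is injective. -/

import Mathlib

open Matrix

/-- The elementary subgroup `E_m(S)` of `SL_m(S)`. -/
def ElemSubgroup (m : ℕ) (S : Type*) [CommRing S] :
    Subgroup (SpecialLinearGroup (Fin m) S) :=
  Subgroup.closure { g | ∃ i j : Fin m, ∃ a : S, i ≠ j ∧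
    (g : Matrix (Fin m) (Fin m) S) = Matrix.transvection i j a }

namespace ElementaryGL

variable {n : Type*} [Fintype n] [DecidableEq n] {S S' : Type*} [CommRing S'] [CommRing S]

/-- The elementary subgroup of `GL n S`, generated by the transvections. -/
def elem (n S : Type*) [Fintype n] [DecidableEq n] [CommRing S] : Subgroup (GL n S) :=
  Subgroup.closure { g | ∃ i j : n, ∃ a : S, i ≠ j ∧ (g : Matrix n n S) = transvection i j a }

/-- A transvection as an element of `GL n S`. -/
def trv (i j : n) (h : i ≠ j) (a : S) : GL n S where
  val := transvection i j a
  inv := transvection i j (-a)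
  val_inv := by simp [transvection_mul_transvection_same, h]
  inv_val := by simp [transvection_mul_transvection_same, h]

@[simp] lemma coe_trv (i j : n) (h : i ≠ j) (a : S) :
    (trv i j h a : Matrix n n S) = transvection i j a := rfl

lemma trv_add (i j : n) (h : i ≠ j) (a b : S) : trv i j h (a + b) = trv i j h a * trv i j h b := by
  ext1; simp [transvection_mul_transvection_same, h]

lemma trv_neg (i j : n) (h : i ≠ j) (a : S) : trv i j h (-a) = (trv i j h a)⁻¹ := by
  rw [eq_inv_iff_mul_eq_one, ← trv_add]; ext1; simp

lemma trv_mem (i j : n) (h : i ≠ j) (a : S) : trv i j h a ∈ elem n S :=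
  Subgroup.subset_closure ⟨i, j, a, h, rfl⟩

lemma map_trv (f : S →+* S') (i j : n) (h : i ≠ j) (a : S) :
    GeneralLinearGroup.map f (trv i j h a) = trv i j h (f a) := by
  apply Units.ext
  simp [GeneralLinearGroup.map, transvection, Matrix.map_add, Matrix.map_single]

/-- Induction by left multiplication with transvections. -/
lemma elem_induction {p : GL n S → Prop} (h1 : p 1)
    (hmul : ∀ i j (h : i ≠ j) (a : S) g, g ∈ elem n S → p g → p (trv i j h a * g))
    {g : GL n S} (hg : g ∈ elem n S) : p g := by
  induction hg using Subgroup.closure_induction_left with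
  | one => exact h1
  | mul_left x hx y hy ih =>
    obtain ⟨i, j, a, h, e⟩ := hx
    rw [show x = trv i j h a from Units.ext e]
    exact hmul i j h a y hy ih
  | inv_mul_cancel x hx y hy ih =>
    obtain ⟨i, j, a, h, e⟩ := hx
    rw [show x = trv i j h a from Units.ext e, ← trv_neg]
    exact hmul i j h _ y hy ih

lemma map_mem (f : S →+* S') {g : GL n S} (hg : g ∈ elem n S) :
    GeneralLinearGroup.map f g ∈ elem n S' := by
  refine elem_induction (p := fun g => GeneralLinearGroup.map f g ∈ elem n S') (by simp) ?_ hg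
  intro i j h a g _ ih
  rw [map_mul, map_trv]
  exact mul_mem (trv_mem _ _ _ _) ih

/-- The inverse transpose automorphism. -/
def contra (n S : Type*) [Fintype n] [DecidableEq n] [CommRing S] : GL n S →* GL n S where
  toFun g := ⟨((g⁻¹ : GL n S) : Matrix n n S)ᵀ, (g : Matrix n n S)ᵀ,
    by rw [← transpose_mul, Units.mul_inv, transpose_one],
    by rw [← transpose_mul, Units.inv_mul, transpose_one]⟩
  map_one' := by apply Units.ext; simp
  map_mul' a b := by
    apply Units.ext
    change ((((a * b)⁻¹ : GL n S)) : Matrix n n S)ᵀ = _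
    rw [_root_.mul_inv_rev, Units.val_mul, transpose_mul]; rfl

lemma coe_contra (g : GL n S) :
    (contra n S g : Matrix n n S) = ((g⁻¹ : GL n S) : Matrix n n S)ᵀ := rfl

@[simp] lemma contra_contra (g : GL n S) : contra n S (contra n S g) = g := by
  apply Units.ext
  rw [coe_contra, ← map_inv, coe_contra, inv_inv, transpose_transpose]

lemma contra_trv (i j : n) (h : i ≠ j) (a : S) :
    contra n S (trv i j h a) = trv j i h.symm (-a) := by
  apply Units.ext
  rw [coe_contra, ← trv_neg]
  simp [transvection]

lemma contra_map (f : S →+* S') (g : GL n S) :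
    contra n S' (GeneralLinearGroup.map f g) = GeneralLinearGroup.map f (contra n S g) := by
  apply Units.ext
  rw [coe_contra, ← map_inv]; rfl

lemma contra_mem {g : GL n S} (hg : g ∈ elem n S) : contra n S g ∈ elem n S := by
  refine elem_induction (p := fun g => contra n S g ∈ elem n S) (by simp) ?_ hg
  intro i j h a g _ ih
  rw [map_mul, contra_trv]
  exact mul_mem (trv_mem _ _ _ _) ih

/-- A matrix is elementary if it underlies an element of the elementary group. -/
def IsElem (M : Matrix n n S) : Prop := ∃ g ∈ elem n S, (g : Matrix n n S) = M

lemma isElem_coe {g : GL n S} : IsElem (g : Matrix n n S) ↔ g ∈ elem n S :=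
  ⟨fun ⟨_, hx, e⟩ => Units.ext e ▸ hx, fun h => ⟨g, h, rfl⟩⟩

lemma IsElem.one : IsElem (1 : Matrix n n S) := ⟨1, one_mem _, rfl⟩

lemma IsElem.mul {M N : Matrix n n S} : IsElem M → IsElem N → IsElem (M * N) := by
  rintro ⟨g, hg, rfl⟩ ⟨h, hh, rfl⟩
  exact ⟨g * h, mul_mem hg hh, rfl⟩

lemma IsElem.transpose {M : Matrix n n S} : IsElem M → IsElem Mᵀ := by
  rintro ⟨g, hg, rfl⟩
  exact ⟨contra n S g⁻¹, contra_mem (inv_mem hg), by rw [coe_contra, inv_inv]⟩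

lemma isElem_transvection (i j : n) (h : i ≠ j) (a : S) : IsElem (transvection i j a) :=
  ⟨trv i j h a, trv_mem i j h a, rfl⟩

lemma isElem_one_add_single_vecMulVec (l : n) (x : n → S) (hx : x l = 0) :
    IsElem (1 + vecMulVec (Pi.single l 1) x) := by
  have key : ∀ s : Finset n, l ∉ s → IsElem (1 + ∑ j ∈ s, Matrix.single l j (x j)) := by
    intro s
    induction s using Finset.induction_on with
    | empty => intro _; simpa using IsElem.one
    | insert a s ha ih =>
      intro hl
      simp only [Finset.mem_insert, not_or] at hl
      have := (isElem_transvection l a hl.1 (x a)).mul (ih hl.2)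
      convert this using 1
      have hz : Matrix.single l a (x a) * ∑ i ∈ s, Matrix.single l i (x i) = 0 := by
        rw [Finset.mul_sum]
        exact Finset.sum_eq_zero fun i _ =>
          Matrix.single_mul_single_of_ne _ _ _ _ (Ne.symm hl.1) _
      rw [Finset.sum_insert ha, transvection, add_mul, mul_add (Matrix.single l a (x a)), hz]
      simp only [one_mul, mul_one, add_zero]
      abel
  convert key (Finset.univ.erase l) (by simp) using 2
  ext i j
  rw [Matrix.sum_apply]
  simp only [vecMulVec_apply, Matrix.single_apply]
  by_cases hi : l = i
  · subst hi
    by_cases hj : j = l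
    · subst hj; simp [hx]
    · rw [Finset.sum_eq_single j]
      · simp
      · intro k _ hk; simp [hk]
      · intro h; simp [hj] at h
  · simp [hi, Ne.symm hi]

lemma isElem_one_add_vecMulVec_single (l : n) (x : n → S) (hx : x l = 0) :
    IsElem (1 + vecMulVec x (Pi.single l 1)) := by
  have := (isElem_one_add_single_vecMulVec l x hx).transpose
  rwa [transpose_add, transpose_one, transpose_vecMulVec] at this

lemma commutator_one_add {A : Type*} [Ring A] (a b : A) (haa : a * a = 0) (hbb : b * b = 0)
    (hba : b * a = 0) :
    (1 + a) * (1 + b) * (1 - a) * (1 - b) = 1 + a * b := by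
  have h1 : (1 + a) * (1 + b) * (1 - a) * (1 - b) = 1 + a * b - a * a - b * b - b * a
      + (a * a) * b + b * a * b - a * (b * b) - a * (b * a) + a * (b * a) * b := by
    noncomm_ring
  rw [h1, haa, hbb, hba]
  simp

/-- A rank one unipotent matrix whose row vector has a zero entry is elementary. -/
lemma isElem_one_add_vecMulVec (v w : n → S) (hwv : w ⬝ᵥ v = 0) (l : n) (hl : w l = 0) :
    IsElem (1 + vecMulVec v w) := by
  set e : n → S := Pi.single l 1
  set v' : n → S := v - v l • e with hv'
  have hwe : w ⬝ᵥ e = 0 := by simp [e, hl]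
  have hwv' : w ⬝ᵥ v' = 0 := by simp [hv', hwv, hwe]
  have hv'l : v' l = 0 := by simp [hv', e]
  have hev' : e ⬝ᵥ v' = 0 := by simp [e, hv'l]
  have hee : e ⬝ᵥ e = 1 := by simp [e]
  have hcomm := commutator_one_add (vecMulVec v' e) (vecMulVec e w)
    (by rw [vecMulVec_mul_vecMulVec, hev']; simp) (by rw [vecMulVec_mul_vecMulVec, hwe]; simp)
    (by rw [vecMulVec_mul_vecMulVec, hwv']; simp)
  have h1 : IsElem (1 + vecMulVec v' w) := by
    have : vecMulVec v' e * vecMulVec e w = vecMulVec v' w := by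
      rw [vecMulVec_mul_vecMulVec, hee, one_smul]
    rw [← this, ← hcomm]
    have e1 : (1 : Matrix n n S) - vecMulVec v' e = 1 + vecMulVec (-v') e := by
      rw [neg_vecMulVec, sub_eq_add_neg]
    have e2 : (1 : Matrix n n S) - vecMulVec e w = 1 + vecMulVec e (-w) := by
      rw [vecMulVec_neg, sub_eq_add_neg]
    rw [e1, e2]
    exact (((isElem_one_add_vecMulVec_single l v' hv'l).mul
      (isElem_one_add_single_vecMulVec l w hl)).mul
      (isElem_one_add_vecMulVec_single l (-v') (by simp [hv'l]))).mul
      (isElem_one_add_single_vecMulVec l (-w) (by simp [hl]))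
  have h2 : IsElem (1 + vecMulVec (v l • e) w) := by
    have := isElem_one_add_single_vecMulVec l (v l • w) (by simp [hl])
    rwa [vecMulVec_smul, ← smul_vecMulVec] at this
  convert h2.mul h1 using 1
  have : v = v l • e + v' := by simp [hv']
  conv_lhs => rw [this, add_vecMulVec]
  rw [add_mul, mul_add, mul_add, vecMulVec_mul_vecMulVec, hwv']
  simp; abel

lemma koszul_dotProduct (v : n → S) (C : Matrix n n S) : ((C - Cᵀ) *ᵥ v) ⬝ᵥ v = 0 := by
  rw [sub_mulVec, sub_dotProduct, mulVec_transpose, ← dotProduct_mulVec,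
    dotProduct_comm, sub_self]

/-- Suslin's lemma: `1 + v wᵀ` is elementary if `w` is a combination of the
Koszul relations of `v`. -/
lemma isElem_koszul (hn : 3 ≤ Fintype.card n) (v : n → S) (C : Matrix n n S) :
    IsElem (1 + vecMulVec v ((C - Cᵀ) *ᵥ v)) := by
  induction C using Matrix.induction_on' with
  | h_zero => simpa using IsElem.one
  | h_add p q hp hq =>
    convert hp.mul hq using 1
    rw [add_mul, mul_add, mul_add, vecMulVec_mul_vecMulVec, koszul_dotProduct]
    have : (p + q - (p + q)ᵀ) *ᵥ v = (p - pᵀ) *ᵥ v + (q - qᵀ) *ᵥ v := by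
      rw [← add_mulVec, transpose_add]; congr 1; abel
    rw [this, vecMulVec_add]
    simp; abel
  | h_std_basis i j x =>
    obtain ⟨l, hl⟩ : ∃ l, l ∉ ({i, j} : Finset n) := by
      by_contra! h
      have := Finset.card_le_two (a := i) (b := j)
      rw [Finset.eq_univ_of_forall h, Finset.card_univ] at this
      omega
    simp only [Finset.mem_insert, Finset.mem_singleton, not_or] at hl
    refine isElem_one_add_vecMulVec _ _ (koszul_dotProduct _ _) l ?_
    simp [sub_mulVec, transpose_single, single_mulVec, hl.1, hl.2]

/-- A row vector orthogonal to a unimodular column is a combination of Koszul relations. -/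
lemma eq_koszul_mulVec (v w u : n → S) (hwv : w ⬝ᵥ v = 0) (huv : u ⬝ᵥ v = 1) :
    w = (vecMulVec w u - (vecMulVec w u)ᵀ) *ᵥ v := by
  rw [sub_mulVec, transpose_vecMulVec, vecMulVec_mulVec, vecMulVec_mulVec, huv, hwv]
  simp

end ElementaryGL

namespace ElementaryGL

variable {n : Type*} [Fintype n] [DecidableEq n] {S S' : Type*} [CommRing S'] [CommRing S]

open Polynomial (X C)
open scoped Polynomial

lemma det_eq_one {g : GL n S} (hg : g ∈ elem n S) : (g : Matrix n n S).det = 1 := by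
  refine elem_induction (p := fun g : GL n S => (g : Matrix n n S).det = 1) (by simp) ?_ hg
  intro i j h a g _ ih
  simp [det_mul, ih, det_transvection_of_ne _ _ h]

lemma coe_conj_trv_eq_one_add_smul (c : GL n S) (i j : n) (h : i ≠ j) (a : S) :
    ((c * trv i j h a * c⁻¹ : GL n S) : Matrix n n S) =
      1 + a • vecMulVec (fun r => (c : Matrix n n S) r i)
        (fun s => ((c⁻¹ : GL n S) : Matrix n n S) j s) := by
  have e : transvection i j a = 1 + a • vecMulVec (Pi.single i 1) (Pi.single j 1) := by
    ext r s
    simp only [transvection, Matrix.add_apply, Matrix.smul_apply, vecMulVec_apply,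
      Matrix.single_apply, Pi.single_apply, eq_comm (a := i), eq_comm (a := j), smul_eq_mul]
    split_ifs <;> simp_all
  rw [Units.val_mul, Units.val_mul, coe_trv, e, mul_add, add_mul, mul_one, Units.mul_inv,
    mul_smul_comm, smul_mul_assoc, mul_vecMulVec, vecMulVec_mul]
  congr 3
  · ext r; simp
  · ext r; simp

/-- A conjugate of a transvection is of Koszul form. -/
lemma coe_conj_trv (c : GL n S) (i j : n) (h : i ≠ j) (a : S) :
    ((c * trv i j h a * c⁻¹ : GL n S) : Matrix n n S) =
      1 + a • vecMulVec (fun r => (c : Matrix n n S) r i)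
        ((vecMulVec (((c⁻¹ : GL n S) : Matrix n n S) j) (((c⁻¹ : GL n S) : Matrix n n S) i) -
          (vecMulVec (((c⁻¹ : GL n S) : Matrix n n S) j)
            (((c⁻¹ : GL n S) : Matrix n n S) i))ᵀ) *ᵥ fun r => (c : Matrix n n S) r i) := by
  rw [coe_conj_trv_eq_one_add_smul, ← eq_koszul_mulVec]
  · have := congrFun (congrFun (Units.inv_mul c) j) i
    rw [Matrix.mul_apply] at this
    simpa [dotProduct, h.symm] using this
  · have := congrFun (congrFun (Units.inv_mul c) i) i
    rw [Matrix.mul_apply] at this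
    simpa [dotProduct] using this

/-- Induction principle for the kernel of the evaluation at zero on the elementary group. -/
lemma elem_eval_zero_induction {p : GL n S[X] → Prop} (h1 : p 1)
    (hmul : ∀ x y, p x → p y → p (x * y))
    (hconj : ∀ c ∈ elem n S, ∀ i j (h : i ≠ j) (f : S[X]),
      p (GeneralLinearGroup.map C c * trv i j h (X * f) * (GeneralLinearGroup.map C c)⁻¹))
    {g : GL n S[X]} (hg : g ∈ elem n S[X])
    (hg0 : GeneralLinearGroup.map (Polynomial.evalRingHom (0 : S)) g = 1) : p g := by
  set q : GL n S[X] → Prop := fun g => ∀ d : GL n S, d ∈ elem n S →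
    p (GeneralLinearGroup.map C d * g * (GeneralLinearGroup.map C
      (GeneralLinearGroup.map (Polynomial.evalRingHom (0 : S)) g))⁻¹ *
      (GeneralLinearGroup.map C d)⁻¹) with hq
  have q1 : q 1 := by
    intro d _
    rw [map_one, map_one, inv_one, mul_one, mul_one, mul_inv_cancel]
    exact h1
  have key : q g := by
    refine elem_induction q1 ?_ hg
    intro i j h a x _ ih d hd
    have e : trv i j h a = trv i j h (X * a.divX) * trv i j h (C (a.eval 0)) := by
      rw [← trv_add]
      congr 1
      conv_lhs => rw [← Polynomial.divX_mul_X_add a]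
      rw [mul_comm, Polynomial.coeff_zero_eq_eval_zero]
    have h2 := ih (d * trv i j h (a.eval 0)) (mul_mem hd (trv_mem _ _ _ _))
    have h3 := hmul _ _ (hconj d hd i j h a.divX) h2
    rw [map_mul (GeneralLinearGroup.map (Polynomial.evalRingHom (0 : S))), map_trv,
      Polynomial.coe_evalRingHom, e]
    simp only [map_mul, map_trv] at h3 ⊢
    generalize GeneralLinearGroup.map C d = D at h3 ⊢
    generalize GeneralLinearGroup.map C (GeneralLinearGroup.map (Polynomial.evalRingHom (0 : S)) x) = x0
      at h3 ⊢
    generalize trv i j h (C (a.eval 0)) = t at h3 ⊢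
    generalize trv i j h (X * a.divX) = u at h3 ⊢
    convert h3 using 1
    simp only [mul_assoc, _root_.mul_inv_rev, inv_mul_cancel_left]
  have := key 1 (one_mem _)
  rwa [hg0, map_one, one_mul, inv_one, mul_one, mul_one] at this

/-- Invertible diagonal matrices. -/
def diag (n S : Type*) [Fintype n] [DecidableEq n] [CommRing S] : (n → Sˣ) →* GL n S where
  toFun u := ⟨diagonal fun i => (u i : S), diagonal fun i => ((u i)⁻¹ : Sˣ),
    by simp, by simp⟩
  map_one' := by apply Units.ext; simp
  map_mul' a b := by apply Units.ext; simp

@[simp] lemma coe_diag (u : n → Sˣ) : (diag n S u : Matrix n n S) = diagonal fun i => (u i : S) :=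
  rfl

lemma contra_diag (u : n → Sˣ) : contra n S (diag n S u) = diag n S u⁻¹ := by
  apply Units.ext
  rw [coe_contra, ← map_inv, coe_diag]
  exact diagonal_transpose _

lemma map_diag (f : S →+* S') (u : n → Sˣ) :
    GeneralLinearGroup.map f (diag n S u) = diag n S' fun i => Units.map (f : S →* S') (u i) := by
  apply Units.ext
  ext i j
  simp [GeneralLinearGroup.map, diagonal_apply]
  split_ifs <;> simp

lemma diag_conj_eq_iff (u : n → Sˣ) (x y : GL n S) :
    diag n S u * x * (diag n S u)⁻¹ = y ↔
      ∀ r s, (u r : S) * (x : Matrix n n S) r s = (y : Matrix n n S) r s * (u s : S) := by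
  rw [mul_inv_eq_iff_eq_mul, Units.ext_iff, ← Matrix.ext_iff]
  simp [diagonal_mul, mul_diagonal]

/-- Conjugating by `diag(1, …, τ, …, 1)` an elementary polynomial matrix which is trivial at zero
gives again an elementary polynomial matrix. -/
lemma exists_diag_conj_of_eval_zero (hn : 3 ≤ Fintype.card n) (φ : S[X] →+* S') (τ : S'ˣ)
    (hτ : φ X = τ) (j : n) {x : GL n S[X]} (hx : x ∈ elem n S[X])
    (hx0 : GeneralLinearGroup.map (Polynomial.evalRingHom (0 : S)) x = 1) :
    ∃ y ∈ elem n S[X], diag n S' (Pi.mulSingle j τ) * GeneralLinearGroup.map φ x *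
      (diag n S' (Pi.mulSingle j τ))⁻¹ = GeneralLinearGroup.map φ y := by
  refine elem_eval_zero_induction (p := fun x => ∃ y ∈ elem n S[X],
    diag n S' (Pi.mulSingle j τ) * GeneralLinearGroup.map φ x *
      (diag n S' (Pi.mulSingle j τ))⁻¹ = GeneralLinearGroup.map φ y) ⟨1, one_mem _, by simp⟩
      ?_ ?_ hx hx0
  · rintro x y ⟨x', hx', ex⟩ ⟨y', hy', ey⟩
    refine ⟨x' * y', mul_mem hx' hy', ?_⟩
    rw [map_mul, map_mul, ← ex, ← ey]
    group
  · intro c hc i l h f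
    set g := GeneralLinearGroup.map C c * trv i l h (X * f) * (GeneralLinearGroup.map C c)⁻¹ with hg
    have hgm := coe_conj_trv (GeneralLinearGroup.map C c) i l h (X * f)
    rw [← hg] at hgm
    set v : n → S[X] := fun r => (GeneralLinearGroup.map C c : Matrix n n S[X]) r i
    set K : Matrix n n S[X] := vecMulVec
      (((GeneralLinearGroup.map C c)⁻¹ : GL n S[X]) l : n → S[X])
      (((GeneralLinearGroup.map C c)⁻¹ : GL n S[X]) i)
    set w := (K - Kᵀ) *ᵥ v with hw
    set v' : n → S[X] := fun r => if r = j then X * v r else v r with hv'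
    set K' : Matrix n n S[X] := Matrix.of fun r s => f * (if r = j ∨ s = j then 1 else X) * K r s
      with hK'
    obtain ⟨y, hy, hym⟩ := isElem_koszul hn v' K'
    have hw' : ∀ s, ((K' - K'ᵀ) *ᵥ v') s = f * if s = j then w s else X * w s := by
      intro s
      simp only [hw, mulVec, dotProduct, Finset.mul_sum]
      split_ifs with hs
      · rw [Finset.mul_sum]
        refine Finset.sum_congr rfl fun r _ => ?_
        by_cases hr : r = j
        · subst hr; subst hs; simp
        · simp [hK', hv', hs, hr]; ring
      · rw [Finset.mul_sum]
        refine Finset.sum_congr rfl fun r _ => ?_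
        by_cases hr : r = j
        · simp [hK', hv', hs, hr]; ring
        · simp [hK', hv', hs, hr]; ring
    refine ⟨y, hy, ?_⟩
    rw [diag_conj_eq_iff]
    intro r s
    rw [GeneralLinearGroup.map_apply, GeneralLinearGroup.map_apply, hgm, hym]
    simp only [Matrix.add_apply, Matrix.smul_apply, vecMulVec_apply, hw', smul_eq_mul, map_add,
      map_mul, hτ, Pi.mulSingle_apply]
    simp only [hv']
    by_cases hr : r = j <;> by_cases hs : s = j
    · simp [hr, hs, hτ]; ring
    · simp [hr, hs, hτ, Ne.symm hs]; ring
    · simp [hr, hs]; ring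
    · simp [hr, hs, hτ]; ring

/-- Conjugating by `diag(1, …, τ, …, 1)` a constant elementary matrix whose column is parabolic. -/
lemma exists_diag_conj_of_col (φ : S[X] →+* S') (τ : S'ˣ)
    (hτ : φ X = τ) (j : n) {p : GL n S} (hp : p ∈ elem n S)
    (hpj : ∀ r, r ≠ j → (p : Matrix n n S) r j = 0) :
    ∃ y ∈ elem n S[X], diag n S' (Pi.mulSingle j τ) *
      GeneralLinearGroup.map φ (GeneralLinearGroup.map C p) *
      (diag n S' (Pi.mulSingle j τ))⁻¹ = GeneralLinearGroup.map φ y := by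
  set b := ((p⁻¹ : GL n S) : Matrix n n S) j j with hb
  have hbp : (p : Matrix n n S) j j * b = 1 := by
    have := congrFun (congrFun (Units.inv_mul p) j) j
    rw [Matrix.mul_apply, Finset.sum_eq_single j (fun r _ hr => by rw [hpj r hr, mul_zero])
      (by simp), Matrix.one_apply_eq] at this
    rw [mul_comm]; exact this
  set z : n → S[X] := fun k => if k = j then 0 else (X - 1) * C (b * (p : Matrix n n S) j k)
  obtain ⟨y, hy, hym⟩ := IsElem.mul ⟨_, map_mem C hp, rfl⟩
    (isElem_one_add_single_vecMulVec j z (by simp [z]))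
  refine ⟨y, hy, ?_⟩
  rw [diag_conj_eq_iff]
  intro r s
  have hyrs : (y : Matrix n n S[X]) r s = C ((p : Matrix n n S) r s) +
      C ((p : Matrix n n S) r j) * z s := by
    rw [hym, mul_add, mul_one, mul_vecMulVec, Matrix.add_apply, vecMulVec_apply]
    simp
  have hm : ∀ (g : GL n S[X]) r s, (GeneralLinearGroup.map φ g : Matrix n n S') r s =
    φ ((g : Matrix n n S[X]) r s) := fun _ _ _ => rfl
  rw [hm, hm, hyrs]
  rw [GeneralLinearGroup.map_apply]
  by_cases hr : r = j
  · subst hr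
    by_cases hs : s = r
    · subst hs; simp [z, mul_comm]
    · have : C ((p : Matrix n n S) r r) * z s = (X - 1) * C ((p : Matrix n n S) r s) := by
        simp only [z, hs, if_false]
        rw [mul_left_comm, ← map_mul, ← mul_assoc, hbp, one_mul]
      rw [this]
      simp [hs, hτ]
      ring
  · rw [hpj r hr]
    by_cases hs : s = j
    · simp [hs, hpj r hr]
    · simp [hr, hs]

lemma diag_conj_vecMulVec (u : n → Sˣ) (x : n → S) (j : n) {g g' : GL n S}
    (hg : (g : Matrix n n S) = 1 + vecMulVec x (Pi.single j 1))
    (hg' : (g' : Matrix n n S) =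
      1 + vecMulVec (fun i => (u i : S) * x i * ((u j)⁻¹ : Sˣ)) (Pi.single j 1)) :
    diag n S u * g * (diag n S u)⁻¹ = g' := by
  rw [diag_conj_eq_iff]
  intro r s
  rw [hg, hg']
  simp only [Matrix.add_apply, vecMulVec_apply, Pi.single_apply]
  by_cases hrs : r = s <;> by_cases hs : s = j
  · subst hrs; subst hs
    simp only [one_apply_eq, if_true, mul_one]
    linear_combination (-(u r : S) * x r) * Units.inv_mul (u r)
  · subst hrs; simp [hs]
  · subst hs; simp [hrs]
  · simp [hrs, hs]

/-- A matrix whose inverse has a unit entry in a column is parabolic up to a unipotent. -/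
lemma exists_col_factorization {c : GL n S} (hc : c ∈ elem n S) (k : n) (x : n → S)
    (hx : ∀ r, r ≠ k → ((c : Matrix n n S) *ᵥ x) r = 0) (hxk : x k = 1) :
    ∃ p ∈ elem n S, (∀ r, r ≠ k → (p : Matrix n n S) r k = 0) ∧ ∃ b ∈ elem n S, c = p * b ∧
      (b : Matrix n n S) = 1 + vecMulVec (Pi.single k 1 - x) (Pi.single k 1) := by
  obtain ⟨b, hb, hbm⟩ := isElem_one_add_vecMulVec_single k (Pi.single k 1 - x) (by simp [hxk])
  refine ⟨c * b⁻¹, mul_mem hc (inv_mem hb), ?_, b, hb, by group, hbm⟩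
  obtain ⟨b', hb', hbm'⟩ := isElem_one_add_vecMulVec_single k (x - Pi.single k 1) (by simp [hxk])
  have : b⁻¹ = b' := by
    rw [inv_eq_iff_mul_eq_one]
    apply Units.ext
    rw [Units.val_mul, hbm, hbm', mul_add, add_mul, add_mul, vecMulVec_mul_vecMulVec]
    simp [hxk, sub_vecMulVec]
    abel
  intro r hr
  rw [this, Units.val_mul, hbm', mul_add, mul_vecMulVec, mul_one, Matrix.add_apply,
    vecMulVec_apply, mulVec_sub, Pi.sub_apply, hx r hr]
  simp

end ElementaryGL

namespace ElementaryGL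

variable {n : Type*} [Fintype n] [DecidableEq n] {A k : Type*} [CommRing A] [CommRing k]

open Polynomial (X)
open scoped Polynomial LaurentPolynomial
open LaurentPolynomial (T)

/-- The variable as a unit of the ring of Laurent polynomials. -/
noncomputable def tau (A : Type*) [CommRing A] : A[T;T⁻¹]ˣ :=
  ⟨T 1, T (-1), by rw [← LaurentPolynomial.T_add]; simp, by rw [← LaurentPolynomial.T_add]; simp⟩

lemma coe_tau : (tau A : A[T;T⁻¹]) = T 1 := rfl

lemma coe_tau_inv : ((tau A)⁻¹ : A[T;T⁻¹]ˣ) = (T (-1) : A[T;T⁻¹]) := rfl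

lemma coe_tau_zpow (m : ℤ) : ((tau A ^ m : A[T;T⁻¹]ˣ) : A[T;T⁻¹]) = T m := by
  cases m with
  | ofNat m => simp [coe_tau, LaurentPolynomial.T_pow]
  | negSucc m =>
    rw [zpow_negSucc, ← inv_pow, Units.val_pow_eq_pow_val, coe_tau_inv, LaurentPolynomial.T_pow]
    congr 1
    simp [Int.negSucc_eq]

/-- Polynomials in the inverse variable. -/
noncomputable def negL (A : Type*) [CommRing A] : A[X] →+* A[T;T⁻¹] :=
  (LaurentPolynomial.invert (R := A) : A[T;T⁻¹] →+* A[T;T⁻¹]).comp Polynomial.toLaurent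

lemma negL_apply (f : A[X]) : negL A f = LaurentPolynomial.invert (Polynomial.toLaurent f) := rfl

@[simp] lemma negL_C (a : A) : negL A (Polynomial.C a) = LaurentPolynomial.C a := by
  simp [negL_apply]

@[simp] lemma negL_X : negL A X = T (-1) := by
  simp [negL_apply]

lemma negL_injective : Function.Injective (negL A) :=
  (LaurentPolynomial.invert (R := A)).injective.comp Polynomial.toLaurent_injective

/-- The map on Laurent polynomials induced by a map of coefficients. -/
noncomputable def mapL (q : A →+* k) : A[T;T⁻¹] →+* k[T;T⁻¹] :=
  LaurentPolynomial.eval₂ (LaurentPolynomial.C.comp q) (tau k)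

@[simp] lemma mapL_C (q : A →+* k) (a : A) :
    mapL q (LaurentPolynomial.C a) = LaurentPolynomial.C (q a) := by
  simp [mapL]

@[simp] lemma mapL_T (q : A →+* k) (m : ℤ) : mapL q (T m) = T m := by
  rw [mapL, LaurentPolynomial.eval₂_T, coe_tau_zpow]

lemma mapL_comp_toLaurent (q : A →+* k) :
    (mapL q).comp Polynomial.toLaurent = Polynomial.toLaurent.comp (Polynomial.mapRingHom q) := by
  apply Polynomial.ringHom_ext <;> simp

lemma mapL_comp_negL (q : A →+* k) :
    (mapL q).comp (negL A) = (negL k).comp (Polynomial.mapRingHom q) := by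
  apply Polynomial.ringHom_ext <;> simp

lemma units_map_mapL_tau (q : A →+* k) : Units.map (mapL q : A[T;T⁻¹] →* k[T;T⁻¹]) (tau A) = tau k := by
  apply Units.ext
  simp [coe_tau]

/-- Matrices with polynomial entries as matrices with Laurent polynomial entries. -/
noncomputable def pos (n A : Type*) [Fintype n] [DecidableEq n] [CommRing A] :
    GL n A[X] →* GL n A[T;T⁻¹] := GeneralLinearGroup.map Polynomial.toLaurent

/-- Matrices with polynomial entries, substituting the inverse of the variable. -/
noncomputable def neg (n A : Type*) [Fintype n] [DecidableEq n] [CommRing A] :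
    GL n A[X] →* GL n A[T;T⁻¹] := GeneralLinearGroup.map (negL A)

/-- Constant matrices. -/
noncomputable def cst (n A : Type*) [Fintype n] [DecidableEq n] [CommRing A] :
    GL n A →* GL n A[T;T⁻¹] := GeneralLinearGroup.map LaurentPolynomial.C

/-- Constant matrices over the polynomial ring. -/
noncomputable def cstP (n A : Type*) [Fintype n] [DecidableEq n] [CommRing A] :
    GL n A →* GL n A[X] := GeneralLinearGroup.map Polynomial.C

/-- The constant term of a polynomial matrix. -/
noncomputable def ev0 (n A : Type*) [Fintype n] [DecidableEq n] [CommRing A] :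
    GL n A[X] →* GL n A := GeneralLinearGroup.map (Polynomial.evalRingHom 0)

/-- Reduction of polynomial matrices. -/
noncomputable def redP (n : Type*) [Fintype n] [DecidableEq n] (q : A →+* k) :
    GL n A[X] →* GL n k[X] := GeneralLinearGroup.map (Polynomial.mapRingHom q)

/-- Reduction of Laurent polynomial matrices. -/
noncomputable def redL (n : Type*) [Fintype n] [DecidableEq n] (q : A →+* k) :
    GL n A[T;T⁻¹] →* GL n k[T;T⁻¹] := GeneralLinearGroup.map (mapL q)

lemma map_injective {S S' : Type*} [CommRing S] [CommRing S'] {f : S →+* S'}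
    (hf : Function.Injective f) :
    Function.Injective (GeneralLinearGroup.map (n := n) f) := by
  intro x y h
  apply Units.ext
  ext i j
  apply hf
  exact congrArg (fun g : GL n S' => (g : Matrix n n S') i j) h

lemma map_map {S S' S'' : Type*} [CommRing S] [CommRing S'] [CommRing S''] (f : S →+* S')
    (g : S' →+* S'') (x : GL n S) : GeneralLinearGroup.map g (GeneralLinearGroup.map f x) =
      GeneralLinearGroup.map (g.comp f) x := rfl

lemma pos_injective : Function.Injective (pos n A) := map_injective Polynomial.toLaurent_injective

lemma neg_injective : Function.Injective (neg n A) := map_injective negL_injective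

lemma pos_cstP (x : GL n A) : pos n A (cstP n A x) = cst n A x := by
  rw [pos, cstP, cst, map_map]
  congr 2
  ext; simp

lemma neg_cstP (x : GL n A) : neg n A (cstP n A x) = cst n A x := by
  rw [neg, cstP, cst, map_map]
  congr 2
  ext; simp

lemma ev0_cstP (x : GL n A) : ev0 n A (cstP n A x) = x := by
  rw [ev0, cstP, map_map, show (Polynomial.evalRingHom (0 : A)).comp Polynomial.C = RingHom.id A by
    ext; simp]
  rfl

lemma redL_pos (q : A →+* k) (x : GL n A[X]) : redL n q (pos n A x) = pos n k (redP n q x) := by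
  rw [redL, pos, map_map, mapL_comp_toLaurent]; rfl

lemma redL_neg (q : A →+* k) (x : GL n A[X]) : redL n q (neg n A x) = neg n k (redP n q x) := by
  rw [redL, neg, map_map, mapL_comp_negL]; rfl

lemma redL_cst (q : A →+* k) (x : GL n A) :
    redL n q (cst n A x) = cst n k (GeneralLinearGroup.map q x) := by
  rw [redL, cst, cst, map_map, map_map]
  congr 2
  ext; simp

lemma redP_cstP (q : A →+* k) (x : GL n A) :
    redP n q (cstP n A x) = cstP n k (GeneralLinearGroup.map q x) := by
  rw [redP, cstP, cstP, map_map, map_map]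
  congr 2
  ext; simp

lemma ev0_redP (q : A →+* k) (x : GL n A[X]) :
    ev0 n k (redP n q x) = GeneralLinearGroup.map q (ev0 n A x) := by
  rw [redP, ev0, ev0, map_map, map_map]
  congr 2
  ext <;> simp

/-- The diagonal matrix with the variable to the powers `l`. -/
noncomputable def dT (A : Type*) [CommRing A] (l : n → ℤ) : GL n A[T;T⁻¹] :=
  diag n _ fun i => tau A ^ l i

lemma dT_add (l l' : n → ℤ) : dT A (l + l') = dT A l * dT A l' := by
  rw [dT, dT, dT, ← map_mul]
  congr 1
  funext i
  exact _root_.zpow_add _ _ _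

@[simp] lemma dT_zero : dT A (0 : n → ℤ) = 1 := by
  simp only [dT, Pi.zero_apply, zpow_zero]
  exact map_one (diag n _)

lemma dT_neg (l : n → ℤ) : dT A (-l) = (dT A l)⁻¹ := by
  rw [eq_inv_iff_mul_eq_one, ← dT_add]
  simp

lemma contra_dT (l : n → ℤ) : contra n _ (dT A l) = (dT A l)⁻¹ := by
  rw [dT, contra_diag, map_inv]

lemma redL_dT (q : A →+* k) (l : n → ℤ) : redL n q (dT A l) = dT k l := by
  rw [redL, dT, dT, map_diag]
  simp only [map_zpow, units_map_mapL_tau]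

lemma coe_dT (l : n → ℤ) : (dT A l : Matrix n n A[T;T⁻¹]) = diagonal fun i => T (l i) := by
  simp [dT, coe_tau_zpow]

lemma dT_single (j : n) : dT A (Pi.single j 1) = diag n _ (Pi.mulSingle j (tau A)) := by
  rw [dT]
  congr 1
  ext i
  by_cases h : i = j
  · subst h; simp
  · simp [h]

lemma dT_single_inv (j : n) :
    (dT A (Pi.single j 1))⁻¹ = diag n _ (Pi.mulSingle j (tau A)⁻¹) := by
  rw [dT_single, ← map_inv, Pi.mulSingle_inv]

lemma dT_conj_trv (l : n → ℤ) (i j : n) (h : i ≠ j) (f : A[T;T⁻¹]) :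
    dT A l * trv i j h f * (dT A l)⁻¹ = trv i j h (T (l i - l j) * f) := by
  rw [dT, diag_conj_eq_iff]
  intro r s
  simp only [coe_tau_zpow, coe_trv, transvection, Matrix.add_apply, Matrix.single_apply, one_apply]
  by_cases hr : i = r
  · by_cases hs : j = s
    · subst hr; subst hs
      simp only [h, if_false, and_self, if_true, zero_add]
      rw [mul_right_comm, ← LaurentPolynomial.T_add]
      simp
    · simp only [hs, and_false, if_false]
      split_ifs with h'
      · subst h'; simp
      · simp
  · simp only [hr, false_and, if_false]
    split_ifs with h'
    · subst h'; simp
    · simp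

/-- A power-of-the-variable conjugate of a polynomial elementary matrix trivial at zero is
polynomial and elementary. -/
lemma conj_pos (hn : 3 ≤ Fintype.card n) (j : n) {x : GL n A[X]} (hx : x ∈ elem n A[X])
    (hx0 : ev0 n A x = 1) : ∃ y ∈ elem n A[X],
      dT A (Pi.single j 1) * pos n A x * (dT A (Pi.single j 1))⁻¹ = pos n A y := by
  rw [dT_single]
  exact exists_diag_conj_of_eval_zero hn _ (tau A) (by simp [coe_tau]) j hx hx0

lemma conj_inv_neg (hn : 3 ≤ Fintype.card n) (j : n) {x : GL n A[X]} (hx : x ∈ elem n A[X])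
    (hx0 : ev0 n A x = 1) : ∃ y ∈ elem n A[X],
      (dT A (Pi.single j 1))⁻¹ * neg n A x * dT A (Pi.single j 1) = neg n A y := by
  obtain ⟨y, hy, e⟩ := exists_diag_conj_of_eval_zero hn (negL A) (tau A)⁻¹
    (by simp [coe_tau_inv]) j hx hx0
  rw [← dT_single_inv, inv_inv] at e
  exact ⟨y, hy, e⟩

lemma contra_pos (x : GL n A[X]) : contra n _ (pos n A x) = pos n A (contra n _ x) :=
  contra_map _ _

lemma contra_neg (x : GL n A[X]) : contra n _ (neg n A x) = neg n A (contra n _ x) :=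
  contra_map _ _

lemma contra_cst (x : GL n A) : contra n _ (cst n A x) = cst n A (contra n _ x) :=
  contra_map _ _

lemma contra_ev0 (x : GL n A[X]) : contra n _ (ev0 n A x) = ev0 n A (contra n _ x) :=
  contra_map _ _

lemma conj_neg (hn : 3 ≤ Fintype.card n) (j : n) {x : GL n A[X]} (hx : x ∈ elem n A[X])
    (hx0 : ev0 n A x = 1) : ∃ y ∈ elem n A[X],
      dT A (Pi.single j 1) * neg n A x * (dT A (Pi.single j 1))⁻¹ = neg n A y := by
  obtain ⟨y, hy, e⟩ := conj_inv_neg hn j (contra_mem hx) (by rw [← contra_ev0, hx0, map_one])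
  refine ⟨contra n _ y, contra_mem hy, ?_⟩
  have := congrArg (contra n _) e
  rwa [map_mul, map_mul, map_inv, contra_dT, contra_neg, contra_neg, contra_contra, inv_inv] at this

lemma conj_pos_of_col (j : n) {p : GL n A} (hp : p ∈ elem n A)
    (hpj : ∀ r, r ≠ j → (p : Matrix n n A) r j = 0) : ∃ y ∈ elem n A[X],
      dT A (Pi.single j 1) * cst n A p * (dT A (Pi.single j 1))⁻¹ = pos n A y := by
  obtain ⟨y, hy, e⟩ := exists_diag_conj_of_col (Polynomial.toLaurent (R := A)) (tau A)
    (by simp [coe_tau]) j hp hpj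
  rw [← pos_cstP, dT_single]
  exact ⟨y, hy, e⟩

lemma conj_neg_of_unipotent (j : n) (x : n → A) {b : GL n A} (hxj : x j = 0)
    (hb : (b : Matrix n n A) = 1 + vecMulVec x (Pi.single j 1)) : ∃ y ∈ elem n A[X],
      dT A (Pi.single j 1) * cst n A b * (dT A (Pi.single j 1))⁻¹ = neg n A y := by
  obtain ⟨y, hy, e⟩ := isElem_one_add_vecMulVec_single j (fun i => X * Polynomial.C (x i))
    (by simp [hxj])
  refine ⟨y, hy, ?_⟩
  rw [dT_single]
  refine diag_conj_vecMulVec _ (fun i => LaurentPolynomial.C (x i)) j ?_ ?_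
  · ext1 r s
    have : (cst n A b : Matrix n n A[T;T⁻¹]) r s = LaurentPolynomial.C ((b : Matrix n n A) r s) :=
      rfl
    rw [this, hb]
    simp [vecMulVec_apply, Matrix.one_apply, Pi.single_apply, apply_ite LaurentPolynomial.C]
  · ext1 r s
    have : (neg n A y : Matrix n n A[T;T⁻¹]) r s = negL A ((y : Matrix n n A[X]) r s) := rfl
    rw [this, e]
    by_cases hr : r = j
    · subst hr
      simp only [Matrix.add_apply, Matrix.one_apply, vecMulVec_apply, hxj, map_zero, mul_zero,
        zero_mul, map_add, apply_ite (negL A), map_one]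
    · simp only [Matrix.add_apply, Matrix.one_apply, vecMulVec_apply, Pi.mulSingle_apply, hr,
        if_false, if_true, Pi.single_apply, map_add, map_mul, apply_ite (negL A), map_one,
        map_zero, negL_X, negL_C, coe_tau_inv, Units.val_one, one_mul]
      rw [mul_comm (T (-1))]

end ElementaryGL

namespace ElementaryGL

variable {n : Type*} [Fintype n] [DecidableEq n] {A k : Type*} [CommRing A] [CommRing k]

open Polynomial (X)
open scoped Polynomial LaurentPolynomial
open LaurentPolynomial (T)

lemma exists_parabolic_mul_unipotent {c : GL n A} (hc : c ∈ elem n A) (j : n) (u : Aˣ)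
    (hu : ((c⁻¹ : GL n A) : Matrix n n A) j j = u) :
    ∃ p ∈ elem n A, (∀ r, r ≠ j → (p : Matrix n n A) r j = 0) ∧ ∃ b ∈ elem n A, c = p * b ∧
      (b : Matrix n n A) = 1 + vecMulVec (fun i => if i = j then 0 else
        -(((c⁻¹ : GL n A) : Matrix n n A) i j * (u⁻¹ : Aˣ))) (Pi.single j 1) := by
  obtain ⟨p, hp, hpj, b, hb, e, hbm⟩ := exists_col_factorization hc j
    (fun i => ((c⁻¹ : GL n A) : Matrix n n A) i j * (u⁻¹ : Aˣ)) (by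
      intro r hr
      have := congrFun (congrFun (Units.mul_inv c) r) j
      rw [Matrix.mul_apply, one_apply_ne hr] at this
      simp only [mulVec, dotProduct, ← mul_assoc, ← Finset.sum_mul]
      rw [this, zero_mul]) (by simp [hu])
  refine ⟨p, hp, hpj, b, hb, e, ?_⟩
  rw [hbm]
  congr 2
  funext i
  by_cases hi : i = j
  · subst hi
    rw [if_pos rfl, Pi.sub_apply, hu, Units.mul_inv, Pi.single_eq_same, sub_self]
  · simp [hi]

lemma cstP_mem {x : GL n A} (hx : x ∈ elem n A) : cstP n A x ∈ elem n A[X] := map_mem _ hx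

lemma ev0_mem {x : GL n A[X]} (hx : x ∈ elem n A[X]) : ev0 n A x ∈ elem n A := map_mem _ hx

lemma exists_eq_mul_cstP {a : GL n A[X]} (ha : a ∈ elem n A[X]) :
    ∃ a₀ ∈ elem n A[X], ev0 n A a₀ = 1 ∧ a = a₀ * cstP n A (ev0 n A a) := by
  refine ⟨a * (cstP n A (ev0 n A a))⁻¹, mul_mem ha (inv_mem (cstP_mem (ev0_mem ha))), ?_, by group⟩
  rw [map_mul, map_inv, ev0_cstP, mul_inv_cancel]

lemma exists_eq_cstP_mul {a : GL n A[X]} (ha : a ∈ elem n A[X]) :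
    ∃ a₀ ∈ elem n A[X], ev0 n A a₀ = 1 ∧ a = cstP n A (ev0 n A a) * a₀ := by
  refine ⟨(cstP n A (ev0 n A a))⁻¹ * a, mul_mem (inv_mem (cstP_mem (ev0_mem ha))) ha, ?_, by group⟩
  rw [map_mul, map_inv, ev0_cstP, inv_mul_cancel]

/-- The products of two elementary matrices over `A[T]` and `A[T⁻¹]` with trivial reduction. -/
def bigCell (n : Type*) [Fintype n] [DecidableEq n] (q : A →+* k) : Set (GL n A[T;T⁻¹]) :=
  {x | ∃ a ∈ elem n A[X], ∃ b ∈ elem n A[X], redP n q a = 1 ∧ redP n q b = 1 ∧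
    x = pos n A a * neg n A b}

variable {q : A →+* k}

lemma one_mem_bigCell : 1 ∈ bigCell n q :=
  ⟨1, one_mem _, 1, one_mem _, map_one _, map_one _, by simp⟩

lemma contra_redP (x : GL n A[X]) : contra n _ (redP n q x) = redP n q (contra n _ x) :=
  contra_map _ _

lemma bigCell_contra {x : GL n A[T;T⁻¹]} (hx : x ∈ bigCell n q) :
    contra n _ x ∈ bigCell n q := by
  obtain ⟨a, ha, b, hb, qa, qb, rfl⟩ := hx
  refine ⟨_, contra_mem ha, _, contra_mem hb, ?_, ?_, by rw [map_mul, contra_pos, contra_neg]⟩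
  · rw [← contra_redP, qa, map_one]
  · rw [← contra_redP, qb, map_one]

lemma bigCell_conj_cst {c : GL n A} (hc : c ∈ elem n A) {x : GL n A[T;T⁻¹]}
    (hx : x ∈ bigCell n q) : cst n A c * x * (cst n A c)⁻¹ ∈ bigCell n q := by
  obtain ⟨a, ha, b, hb, qa, qb, rfl⟩ := hx
  refine ⟨cstP n A c * a * (cstP n A c)⁻¹, mul_mem (mul_mem (cstP_mem hc) ha)
    (inv_mem (cstP_mem hc)), cstP n A c * b * (cstP n A c)⁻¹, mul_mem (mul_mem (cstP_mem hc) hb)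
    (inv_mem (cstP_mem hc)), by simp [qa], by simp [qb], ?_⟩
  simp only [map_mul, map_inv, pos_cstP, neg_cstP]
  group

lemma bigCell_conj_dT [IsLocalHom q] (hn : 3 ≤ Fintype.card n) (j : n) {x : GL n A[T;T⁻¹]}
    (hx : x ∈ bigCell n q) :
    dT A (Pi.single j 1) * x * (dT A (Pi.single j 1))⁻¹ ∈ bigCell n q := by
  obtain ⟨a, ha, b, hb, qa, qb, rfl⟩ := hx
  obtain ⟨a₀, ha₀, ea₀, ea⟩ := exists_eq_mul_cstP ha
  obtain ⟨b₀, hb₀, eb₀, eb⟩ := exists_eq_cstP_mul hb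
  set α := ev0 n A a
  set β := ev0 n A b
  have hα : α ∈ elem n A := ev0_mem ha
  have hβ : β ∈ elem n A := ev0_mem hb
  have qα : GeneralLinearGroup.map q α = 1 := by rw [← ev0_redP, qa, map_one]
  have qβ : GeneralLinearGroup.map q β = 1 := by rw [← ev0_redP, qb, map_one]
  have qa₀ : redP n q a₀ = 1 := by
    have := qa
    rw [ea, map_mul, redP_cstP, qα, map_one, mul_one] at this
    exact this
  have qb₀ : redP n q b₀ = 1 := by
    have := qb
    rw [eb, map_mul, redP_cstP, qβ, map_one, one_mul] at this
    exact this
  have hc : α * β ∈ elem n A := mul_mem hα hβ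
  have qc : GeneralLinearGroup.map q (α * β) = 1 := by rw [map_mul, qα, qβ, one_mul]
  have qci : ∀ r s, q ((((α * β)⁻¹ : GL n A) : Matrix n n A) r s) = (1 : Matrix n n k) r s := by
    intro r s
    have : GeneralLinearGroup.map q (α * β)⁻¹ = 1 := by rw [map_inv, qc, inv_one]
    exact congrArg (fun g : GL n k => (g : Matrix n n k) r s) this
  have hu : IsUnit ((((α * β)⁻¹ : GL n A) : Matrix n n A) j j) := by
    apply isUnit_of_map_unit q
    rw [qci, one_apply_eq]
    exact isUnit_one
  obtain ⟨u, hu⟩ := hu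
  obtain ⟨p, hp, hpj, b', hb', ec, hbm⟩ := exists_parabolic_mul_unipotent hc j u hu.symm
  have qb' : GeneralLinearGroup.map q b' = 1 := by
    apply Units.ext
    ext r s
    rw [GeneralLinearGroup.map_apply, hbm]
    by_cases hr : r = j
    · subst hr
      simp [vecMulVec_apply, Matrix.one_apply, apply_ite q]
    · rw [Matrix.add_apply, map_add, vecMulVec_apply, if_neg hr, map_mul, map_neg, map_mul, qci,
        one_apply_ne hr]
      simp [Matrix.one_apply, apply_ite q]
  have qp : GeneralLinearGroup.map q p = 1 := by
    have := qc
    rw [ec, map_mul, qb', mul_one] at this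
    exact this
  obtain ⟨y₁, hy₁, e₁⟩ := conj_pos hn j ha₀ ea₀
  obtain ⟨y₂, hy₂, e₂⟩ := conj_pos_of_col j hp hpj
  obtain ⟨y₃, hy₃, e₃⟩ := conj_neg_of_unipotent j _ (by simp) hbm
  obtain ⟨y₄, hy₄, e₄⟩ := conj_neg hn j hb₀ eb₀
  have qd : ∀ x y : GL n A[T;T⁻¹], redL n q x = 1 →
      dT A (Pi.single j 1) * x * (dT A (Pi.single j 1))⁻¹ = y → redL n q y = 1 := by
    intro x y hx e
    rw [← e, map_mul, map_mul, hx, map_inv, mul_one, mul_inv_cancel]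
  have qy₁ : redP n q y₁ = 1 := by
    apply pos_injective
    rw [← redL_pos, qd _ _ _ e₁, map_one]
    rw [redL_pos, qa₀, map_one]
  have qy₂ : redP n q y₂ = 1 := by
    apply pos_injective
    rw [← redL_pos, qd _ _ _ e₂, map_one]
    rw [redL_cst, qp, map_one]
  have qy₃ : redP n q y₃ = 1 := by
    apply neg_injective
    rw [← redL_neg, qd _ _ _ e₃, map_one]
    rw [redL_cst, qb', map_one]
  have qy₄ : redP n q y₄ = 1 := by
    apply neg_injective
    rw [← redL_neg, qd _ _ _ e₄, map_one]
    rw [redL_neg, qb₀, map_one]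
  refine ⟨y₁ * y₂, mul_mem hy₁ hy₂, y₃ * y₄, mul_mem hy₃ hy₄, by rw [map_mul, qy₁, qy₂, one_mul],
    by rw [map_mul, qy₃, qy₄, one_mul], ?_⟩
  have : pos n A a * neg n A b = pos n A a₀ * cst n A p * cst n A b' * neg n A b₀ := by
    rw [ea, eb, map_mul, map_mul, pos_cstP, neg_cstP, mul_assoc _ (cst n A p), ← map_mul, ← ec,
      map_mul]
    group
  rw [this, map_mul, map_mul, ← e₁, ← e₂, ← e₃, ← e₄]
  group

lemma bigCell_conj_dT_inv [IsLocalHom q] (hn : 3 ≤ Fintype.card n) (j : n) {x : GL n A[T;T⁻¹]}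
    (hx : x ∈ bigCell n q) :
    (dT A (Pi.single j 1))⁻¹ * x * dT A (Pi.single j 1) ∈ bigCell n q := by
  have := bigCell_contra (bigCell_conj_dT hn j (bigCell_contra hx))
  rwa [map_mul, map_mul, map_inv, contra_dT, contra_contra, inv_inv] at this

lemma trv_mul_mem_bigCell (i j : n) (h : i ≠ j) (a : A) (ha : q a = 0) {x : GL n A[T;T⁻¹]}
    (hx : x ∈ bigCell n q) : trv i j h (LaurentPolynomial.C a) * x ∈ bigCell n q := by
  obtain ⟨a', ha', b, hb, qa, qb, rfl⟩ := hx
  refine ⟨trv i j h (Polynomial.C a) * a', mul_mem (trv_mem _ _ _ _) ha', b, hb, ?_, qb, ?_⟩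
  · rw [map_mul, qa, mul_one, redP, map_trv]
    apply Units.ext
    simp [ha]
  · rw [map_mul, pos, map_trv, Polynomial.toLaurent_C, mul_assoc]

/-- The group generated by the constant elementary matrices and the powers of the variable. -/
noncomputable def affH (n A : Type*) [Fintype n] [DecidableEq n] [CommRing A] : Subgroup (GL n A[T;T⁻¹]) :=
  Subgroup.closure ({x | ∃ c ∈ elem n A, x = cst n A c} ∪ {x | ∃ j, x = dT A (Pi.single j 1)})

lemma cst_mem_affH {c : GL n A} (hc : c ∈ elem n A) : cst n A c ∈ affH n A :=
  Subgroup.subset_closure (Or.inl ⟨c, hc, rfl⟩)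

lemma dT_mem_affH (l : n → ℤ) : dT A l ∈ affH n A := by
  have h1 : ∀ j, ∀ m : ℤ, dT A (Pi.single j m) ∈ affH n A := by
    intro j m
    have h0 : dT A (Pi.single j 1) ∈ affH n A := Subgroup.subset_closure (Or.inr ⟨j, rfl⟩)
    have h2 : ∀ m : ℕ, dT A (Pi.single j (m : ℤ)) ∈ affH n A := by
      intro m
      induction m with
      | zero => simp [one_mem]
      | succ m ih =>
        rw [Nat.cast_succ, Pi.single_add, dT_add]
        exact mul_mem ih h0
    obtain ⟨m, rfl | rfl⟩ := m.eq_nat_or_neg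
    · exact h2 m
    · rw [Pi.single_neg, dT_neg]
      exact inv_mem (h2 m)
  have h2 : ∀ s : Finset n, dT A (∑ j ∈ s, Pi.single j (l j)) ∈ affH n A := by
    intro s
    induction s using Finset.induction_on with
    | empty => simp [one_mem]
    | insert a s ha ih =>
      rw [Finset.sum_insert ha, dT_add]
      exact mul_mem (h1 _ _) ih
  have := h2 Finset.univ
  rwa [Finset.univ_sum_single] at this

lemma trv_mem_affH (i j : n) (h : i ≠ j) (f : A[T;T⁻¹]) : trv i j h f ∈ affH n A := by
  induction f using LaurentPolynomial.induction_on' with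
  | add p q hp hq => rw [trv_add]; exact mul_mem hp hq
  | C_mul_T m a =>
    have := dT_conj_trv (A := A) (Pi.single i m) i j h (LaurentPolynomial.C a)
    rw [Pi.single_eq_same, Pi.single_eq_of_ne h.symm, sub_zero, mul_comm] at this
    rw [← this]
    refine mul_mem (mul_mem (dT_mem_affH _) ?_) (inv_mem (dT_mem_affH _))
    rw [← map_trv]
    exact cst_mem_affH (trv_mem _ _ _ _)

lemma elem_le_affH : elem n A[T;T⁻¹] ≤ affH n A := by
  intro x hx
  refine elem_induction (p := fun x => x ∈ affH n A) (one_mem _) ?_ hx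
  intro i j h a g _ ih
  exact mul_mem (trv_mem_affH _ _ _ _) ih

lemma contra_mem_affH {x : GL n A[T;T⁻¹]} (hx : x ∈ affH n A) : contra n _ x ∈ affH n A := by
  induction hx using Subgroup.closure_induction with
  | mem x hx =>
    obtain ⟨c, hc, rfl⟩ | ⟨j, rfl⟩ := hx
    · rw [contra_cst]; exact cst_mem_affH (contra_mem hc)
    · rw [contra_dT]; exact inv_mem (dT_mem_affH _)
  | one => rw [map_one]; exact one_mem _
  | mul x y _ _ hx hy => rw [map_mul]; exact mul_mem hx hy
  | inv x _ hx => rw [map_inv]; exact inv_mem hx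

lemma bigCell_conj_affH [IsLocalHom q] (hn : 3 ≤ Fintype.card n) {h : GL n A[T;T⁻¹]}
    (hh : h ∈ affH n A) : ∀ x ∈ bigCell n q, h * x * h⁻¹ ∈ bigCell n q ∧
      h⁻¹ * x * h ∈ bigCell n q := by
  induction hh using Subgroup.closure_induction with
  | mem h hh =>
    obtain ⟨c, hc, rfl⟩ | ⟨j, rfl⟩ := hh
    · intro x hx
      refine ⟨bigCell_conj_cst hc hx, ?_⟩
      have := bigCell_conj_cst (inv_mem hc) hx
      rwa [map_inv, inv_inv] at this
    · intro x hx
      exact ⟨bigCell_conj_dT hn j hx, bigCell_conj_dT_inv hn j hx⟩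
  | one => intro x hx; simpa using hx
  | mul g h _ _ hg hh =>
    intro x hx
    have h1 := (hg _ (hh x hx).1).1
    have h2 := (hh _ (hg x hx).2).2
    constructor
    · convert h1 using 1; group
    · convert h2 using 1; group
  | inv g _ hg =>
    intro x hx
    rw [inv_inv]
    exact (hg x hx).symm

/-- The normal closure of the constant transvections with trivial reduction. -/
noncomputable def eStar (n : Type*) [Fintype n] [DecidableEq n] (q : A →+* k) : Subgroup (GL n A[T;T⁻¹]) :=
  Subgroup.closure {x | ∃ h ∈ affH n A, ∃ i j, ∃ hij : i ≠ j, ∃ a, q a = 0 ∧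
    x = h * trv i j hij (LaurentPolynomial.C a) * h⁻¹}

lemma eStar_conj {h : GL n A[T;T⁻¹]} (hh : h ∈ affH n A) {x : GL n A[T;T⁻¹]}
    (hx : x ∈ eStar n q) : h * x * h⁻¹ ∈ eStar n q := by
  induction hx using Subgroup.closure_induction with
  | mem x hx =>
    obtain ⟨g, hg, i, j, hij, a, ha, rfl⟩ := hx
    exact Subgroup.subset_closure ⟨h * g, mul_mem hh hg, i, j, hij, a, ha, by group⟩
  | one => simp [one_mem]
  | mul x y _ _ hx hy => convert mul_mem hx hy using 1; group
  | inv x _ hx => convert inv_mem hx using 1; group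

lemma eStar_contra {x : GL n A[T;T⁻¹]} (hx : x ∈ eStar n q) : contra n _ x ∈ eStar n q := by
  induction hx using Subgroup.closure_induction with
  | mem x hx =>
    obtain ⟨g, hg, i, j, hij, a, ha, rfl⟩ := hx
    refine Subgroup.subset_closure ⟨contra n _ g, contra_mem_affH hg, j, i, hij.symm, -a,
      by simp [ha], ?_⟩
    rw [map_mul, map_mul, contra_trv, map_inv, map_neg]
  | one => rw [map_one]; exact one_mem _
  | mul x y _ _ hx hy => rw [map_mul]; exact mul_mem hx hy
  | inv x _ hx => rw [map_inv]; exact inv_mem hx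

lemma trv_mem_eStar (i j : n) (h : i ≠ j) (a : A) (ha : q a = 0) (m : ℤ) :
    trv i j h (LaurentPolynomial.C a * T m) ∈ eStar n q := by
  have := dT_conj_trv (A := A) (Pi.single i m) i j h (LaurentPolynomial.C a)
  rw [Pi.single_eq_same, Pi.single_eq_of_ne h.symm, sub_zero, mul_comm] at this
  rw [← this]
  exact Subgroup.subset_closure ⟨_, dT_mem_affH _, i, j, h, a, ha, rfl⟩

lemma redL_eStar {x : GL n A[T;T⁻¹]} (hx : x ∈ eStar n q) : redL n q x = 1 := by
  induction hx using Subgroup.closure_induction with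
  | mem x hx =>
    obtain ⟨g, hg, i, j, hij, a, ha, rfl⟩ := hx
    have : redL n q (trv i j hij (LaurentPolynomial.C a)) = 1 := by
      rw [redL, map_trv, mapL_C, ha, map_zero]
      apply Units.ext; simp
    rw [map_mul, map_mul, this, map_inv, mul_one, mul_inv_cancel]
  | one => rw [map_one]
  | mul x y _ _ hx hy => rw [map_mul, hx, hy, one_mul]
  | inv x _ hx => rw [map_inv, hx, inv_one]

lemma eStar_subset_bigCell [IsLocalHom q] (hn : 3 ≤ Fintype.card n) {x : GL n A[T;T⁻¹]}
    (hx : x ∈ eStar n q) : x ∈ bigCell n q := by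
  have key : ∀ g ∈ affH n A, ∀ i j, ∀ hij : i ≠ j, ∀ a, q a = 0 → ∀ y ∈ bigCell n q,
      g * trv i j hij (LaurentPolynomial.C a) * g⁻¹ * y ∈ bigCell n q := by
    intro g hg i j hij a ha y hy
    have := (bigCell_conj_affH hn hg _ (trv_mul_mem_bigCell i j hij a ha
      (bigCell_conj_affH hn hg y hy).2)).1
    convert this using 1
    group
  induction hx using Subgroup.closure_induction_left with
  | one => exact one_mem_bigCell
  | mul_left x hx y _ ih =>
    obtain ⟨g, hg, i, j, hij, a, ha, rfl⟩ := hx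
    exact key g hg i j hij a ha y ih
  | inv_mul_cancel x hx y _ ih =>
    obtain ⟨g, hg, i, j, hij, a, ha, rfl⟩ := hx
    convert key g hg i j hij (-a) (by simp [ha]) y ih using 1
    rw [map_neg, trv_neg]
    group

end ElementaryGL

namespace ElementaryGL

variable {n : Type*} [Fintype n] [DecidableEq n] {A k : Type*} [CommRing A] [CommRing k]

open Polynomial (X)
open scoped Polynomial LaurentPolynomial
open LaurentPolynomial (T)

lemma exists_mem_coe_eq_one_add (K : Subgroup (GL n A)) (l : n) (x : n → A) (hx : x l = 0)
    (hK : ∀ i, ∀ h : i ≠ l, trv i l h (x i) ∈ K) :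
    ∃ g ∈ K, (g : Matrix n n A) = 1 + vecMulVec x (Pi.single l 1) := by
  have key : ∀ s : Finset n, ∃ g ∈ K, (g : Matrix n n A) =
      1 + vecMulVec (fun i => if i ∈ s then x i else 0) (Pi.single l 1) := by
    intro s
    induction s using Finset.induction_on with
    | empty => exact ⟨1, one_mem _, by ext; simp [vecMulVec_apply]⟩
    | insert a s ha ih =>
      obtain ⟨g, hg, e⟩ := ih
      by_cases hal : a = l
      · refine ⟨g, hg, ?_⟩
        rw [e]
        congr 2
        funext i
        by_cases hi : i = l
        · subst hi; simp [hx]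
        · simp [Finset.mem_insert, hal, hi]
      · refine ⟨trv a l hal (x a) * g, mul_mem (hK a hal) hg, ?_⟩
        rw [Units.val_mul, e, coe_trv, transvection, mul_add, mul_one, mul_vecMulVec, add_mulVec,
          one_mulVec, single_mulVec]
        ext r s'
        simp only [Matrix.add_apply, Pi.add_apply, vecMulVec_apply, Function.update_apply,
          Pi.zero_apply, Matrix.single_apply, hx, ite_self, Finset.mem_insert, Pi.single_apply,
          mul_zero, add_zero]
        by_cases hr : a = r
        · subst hr
          by_cases hs : l = s'
          · subst hs; simp [ha]
          · simp [hs, Ne.symm hs]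
        · simp [hr, Ne.symm hr]
  obtain ⟨g, hg, e⟩ := key Finset.univ
  exact ⟨g, hg, by simpa using e⟩

lemma exists_elem_swap (j l : n) : ∃ w ∈ elem n A,
    (∀ r, (w : Matrix n n A) r l = if r = j then 1 else 0) ∧
    ∀ s, (w : Matrix n n A) j s = if s = l then 1 else 0 := by
  by_cases h : j = l
  · subst h
    refine ⟨1, one_mem _, ?_, ?_⟩ <;> intro r <;> simp [Matrix.one_apply, eq_comm]
  · refine ⟨trv j l h 1 * trv l j (Ne.symm h) (-1) * trv j l h 1,
      mul_mem (mul_mem (trv_mem _ _ _ _) (trv_mem _ _ _ _)) (trv_mem _ _ _ _), ?_⟩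
    have : ((trv j l h 1 * trv l j (Ne.symm h) (-1) * trv j l h 1 : GL n A) : Matrix n n A) =
        1 + Matrix.single j l 1 - Matrix.single l j 1 - Matrix.single j j 1 -
          Matrix.single l l 1 := by
      simp only [Units.val_mul, coe_trv, transvection, add_mul, mul_add, mul_one, one_mul,
        Matrix.single_mul_single_same, Matrix.single_mul_single_of_ne _ _ _ _ (Ne.symm h)]
      have hneg : ∀ a b : n, Matrix.single a b (-1 : A) = -Matrix.single a b 1 := fun a b => by
        ext
        simp only [Matrix.neg_apply, Matrix.single_apply]
        split_ifs <;> simp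
      simp only [hneg]
      abel
    rw [this]
    constructor
    · intro r
      simp only [Matrix.sub_apply, Matrix.add_apply, Matrix.single_apply, Matrix.one_apply]
      by_cases hr : r = j
      · subst hr; simp [h, Ne.symm h]
      · by_cases hr' : r = l
        · subst hr'; simp [h, Ne.symm h]
        · simp [h, hr, hr', Ne.symm hr, Ne.symm hr']
    · intro r
      simp only [Matrix.sub_apply, Matrix.add_apply, Matrix.single_apply, Matrix.one_apply]
      by_cases hr : r = j
      · subst hr; simp [h, Ne.symm h]
      · by_cases hr' : r = l
        · subst hr'; simp [h, Ne.symm h]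
        · simp [Ne.symm h, hr', Ne.symm hr, Ne.symm hr']

lemma swap_dT {w : GL n A} {j l : n}
    (h1 : ∀ r, (w : Matrix n n A) r l = if r = j then 1 else 0)
    (h2 : ∀ s, (w : Matrix n n A) j s = if s = l then 1 else 0) :
    dT A (Pi.single j 1) * cst n A w = cst n A w * dT A (Pi.single l 1) := by
  apply Units.ext
  ext1 r s
  have hw : ∀ r s, (cst n A w : Matrix n n A[T;T⁻¹]) r s =
    LaurentPolynomial.C ((w : Matrix n n A) r s) := fun _ _ => rfl
  rw [Units.val_mul, Units.val_mul, coe_dT, coe_dT, diagonal_mul, mul_diagonal, hw]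
  by_cases hr : r = j
  · subst hr
    by_cases hs : s = l
    · subst hs; rw [Pi.single_eq_same, Pi.single_eq_same, mul_comm]
    · rw [h2, if_neg hs, map_zero, mul_zero, zero_mul]
  · by_cases hs : s = l
    · subst hs; rw [h1, if_neg hr, map_zero, mul_zero, zero_mul]
    · rw [Pi.single_eq_of_ne hr, Pi.single_eq_of_ne hs, mul_comm]

/-- The group generated by `eStar` and the elementary matrices over `A[T⁻¹]`. -/
noncomputable def negK (n : Type*) [Fintype n] [DecidableEq n] (q : A →+* k) :
    Subgroup (GL n A[T;T⁻¹]) :=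
  eStar n q ⊔ (elem n A[X]).map (neg n A)

variable {q : A →+* k}

lemma eStar_le_negK : eStar n q ≤ negK n q := le_sup_left

lemma neg_mem_negK {b : GL n A[X]} (hb : b ∈ elem n A[X]) : neg n A b ∈ negK n q :=
  le_sup_right (a := eStar n q) (Subgroup.mem_map_of_mem _ hb)

lemma contra_mem_negK {x : GL n A[T;T⁻¹]} (hx : x ∈ negK n q) : contra n _ x ∈ negK n q := by
  have : negK n q ≤ (negK n q).comap (contra n _) := by
    refine sup_le (fun x hx => eStar_le_negK (eStar_contra hx)) ?_
    rintro _ ⟨b, hb, rfl⟩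
    rw [Subgroup.mem_comap, contra_neg]
    exact neg_mem_negK (contra_mem hb)
  exact this hx

open scoped Pointwise in
lemma exists_of_mem_negK {x : GL n A[T;T⁻¹]} (hx : x ∈ negK n q) :
    ∃ e ∈ eStar n q, ∃ b ∈ elem n A[X], x = e * neg n A b := by
  have hle : (elem n A[X]).map (neg n A) ≤
      Subgroup.normalizer (eStar n q : Set (GL n A[T;T⁻¹])) := by
    rw [Subgroup.le_normalizer_iff]
    rintro _ ⟨b, hb, rfl⟩ e he
    exact eStar_conj (elem_le_affH (map_mem _ hb)) he
  have := Subgroup.coe_mul_of_right_le_normalizer_left (eStar n q) _ hle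
  have hx' : x ∈ (eStar n q : Set (GL n A[T;T⁻¹])) *
      ((elem n A[X]).map (neg n A) : Set (GL n A[T;T⁻¹])) := by
    rw [← this]; exact hx
  obtain ⟨e, he, _, ⟨b, hb, rfl⟩, rfl⟩ := Set.mem_mul.1 hx'
  exact ⟨e, he, b, hb, rfl⟩

/-- The Bruhat-type set of products of an elementary matrix over `A[T]`, powers of the variable and
an element of `negK`. -/
def bruhatSet (n : Type*) [Fintype n] [DecidableEq n] (q : A →+* k) : Set (GL n A[T;T⁻¹]) :=
  {x | ∃ a ∈ elem n A[X], ∃ l : n → ℤ, ∃ e ∈ negK n q, x = pos n A a * dT A l * e}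

lemma bruhatSet_contra {x : GL n A[T;T⁻¹]} (hx : x ∈ bruhatSet n q) :
    contra n _ x ∈ bruhatSet n q := by
  obtain ⟨a, ha, l, e, he, rfl⟩ := hx
  refine ⟨_, contra_mem ha, -l, _, contra_mem_negK he, ?_⟩
  rw [map_mul, map_mul, contra_pos, contra_dT, dT_neg]

lemma cst_mul_mem_bruhatSet {c : GL n A} (hc : c ∈ elem n A) {x : GL n A[T;T⁻¹]}
    (hx : x ∈ bruhatSet n q) : cst n A c * x ∈ bruhatSet n q := by
  obtain ⟨a, ha, l, e, he, rfl⟩ := hx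
  refine ⟨cstP n A c * a, mul_mem (cstP_mem hc) ha, l, e, he, ?_⟩
  rw [map_mul, pos_cstP]
  simp only [mul_assoc]

lemma exists_isUnit_col [IsLocalRing A] (c : GL n A) (j : n) :
    ∃ i, IsUnit (((c⁻¹ : GL n A) : Matrix n n A) i j) := by
  by_contra! h
  have := congrFun (congrFun (Units.mul_inv c) j) j
  rw [Matrix.mul_apply, one_apply_eq] at this
  have h1 : (1 : A) ∈ IsLocalRing.maximalIdeal A := by
    rw [← this]
    refine sum_mem fun i _ => Ideal.mul_mem_left _ _ ?_
    exact (IsLocalRing.mem_maximalIdeal _).2 (h i)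
  exact (IsLocalRing.mem_maximalIdeal _).1 h1 isUnit_one

lemma dT_mul_mem_bruhatSet [IsLocalRing A] (hn : 3 ≤ Fintype.card n) (j : n) {x : GL n A[T;T⁻¹]}
    (hx : x ∈ bruhatSet n (IsLocalRing.residue A)) :
    dT A (Pi.single j 1) * x ∈ bruhatSet n (IsLocalRing.residue A) := by
  classical
  obtain ⟨a, ha, l, e, he, rfl⟩ := hx
  obtain ⟨a₀, ha₀, ea₀, ea⟩ := exists_eq_mul_cstP ha
  set c := ev0 n A a
  have hc : c ∈ elem n A := ev0_mem ha
  obtain ⟨m, hm, hmin⟩ := Finset.exists_min_image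
    (Finset.univ.filter fun i => IsUnit (((c⁻¹ : GL n A) : Matrix n n A) i j)) l
    (by obtain ⟨i, hi⟩ := exists_isUnit_col c j; exact ⟨i, by simpa using hi⟩)
  rw [Finset.mem_filter] at hm
  obtain ⟨u, hu⟩ := hm.2
  obtain ⟨w, hw, hw1, hw2⟩ := exists_elem_swap (A := A) j m
  have hcw : ∀ i, (((w⁻¹ * c)⁻¹ : GL n A) : Matrix n n A) i m =
      ((c⁻¹ : GL n A) : Matrix n n A) i j := by
    intro i
    rw [_root_.mul_inv_rev, inv_inv, Units.val_mul, Matrix.mul_apply]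
    simp only [hw1, mul_ite, mul_one, mul_zero, Finset.sum_ite_eq', Finset.mem_univ, if_true]
  obtain ⟨p, hp, hpm, b, hb, ec, hbm⟩ := exists_parabolic_mul_unipotent
    (mul_mem (inv_mem hw) hc) m u (by rw [hcw, hu])
  simp only [hcw] at hbm
  obtain ⟨y₁, hy₁, e₁⟩ := conj_pos hn j ha₀ ea₀
  obtain ⟨y₂, hy₂, e₂⟩ := conj_pos_of_col m hp hpm
  have hbK : dT A (-l) * cst n A b * (dT A (-l))⁻¹ ∈ negK n (IsLocalRing.residue A) := by
    obtain ⟨g, hg, eg⟩ := exists_mem_coe_eq_one_add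
      ((negK n (IsLocalRing.residue A)).comap (MulAut.conj (dT A (-l))).toMonoidHom) m
      (fun i => LaurentPolynomial.C (if i = m then 0 else
        -(((c⁻¹ : GL n A) : Matrix n n A) i j * (u⁻¹ : Aˣ)))) (by simp) (by
        intro i hi
        rw [Subgroup.mem_comap]
        change dT A (-l) * trv i m hi _ * (dT A (-l))⁻¹ ∈ _
        rw [dT_conj_trv, if_neg hi]
        by_cases hiu : IsUnit (((c⁻¹ : GL n A) : Matrix n n A) i j)
        · have hle := hmin i (by simpa using hiu)
          obtain ⟨d, hd⟩ := Int.eq_ofNat_of_zero_le (sub_nonneg.2 hle)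
          have hd' : (-l) i - (-l) m = -(d : ℤ) := by
            simp only [Pi.neg_apply]; omega
          have : T ((-l) i - (-l) m) * LaurentPolynomial.C
              (-(((c⁻¹ : GL n A) : Matrix n n A) i j * (u⁻¹ : Aˣ))) = negL A (X ^ d * Polynomial.C
              (-(((c⁻¹ : GL n A) : Matrix n n A) i j * (u⁻¹ : Aˣ)))) := by
            rw [hd', map_mul, map_pow, negL_X, negL_C, LaurentPolynomial.T_pow, mul_neg, mul_one]
          rw [this, ← map_trv]
          exact neg_mem_negK (trv_mem _ _ _ _)
        · rw [mul_comm]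
          refine eStar_le_negK (trv_mem_eStar _ _ _ _ ?_ _)
          rw [IsLocalRing.residue_eq_zero_iff]
          exact neg_mem (Ideal.mul_mem_right _ _ ((IsLocalRing.mem_maximalIdeal _).2 hiu)))
    have : g = cst n A b := by
      apply Units.ext
      rw [eg]
      ext1 r s
      have : (cst n A b : Matrix n n A[T;T⁻¹]) r s = LaurentPolynomial.C ((b : Matrix n n A) r s) :=
        rfl
      rw [this, hbm, Matrix.add_apply, Matrix.add_apply, vecMulVec_apply, vecMulVec_apply, map_add,
        map_mul]
      simp only [Matrix.one_apply, Pi.single_apply, apply_ite LaurentPolynomial.C, map_one, map_zero]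
    rw [this] at hg
    exact hg
  refine ⟨y₁ * cstP n A w * y₂, mul_mem (mul_mem hy₁ (cstP_mem hw)) hy₂, Pi.single m 1 + l,
    dT A (-l) * cst n A b * (dT A (-l))⁻¹ * e, mul_mem hbK he, ?_⟩
  have hca : pos n A a = pos n A a₀ * cst n A w * cst n A p * cst n A b := by
    rw [ea, map_mul, pos_cstP, show c = w * (p * b) by rw [← ec]; group, map_mul, map_mul]
    group
  rw [hca, map_mul, map_mul, pos_cstP, ← e₁, ← e₂, dT_add, dT_neg]
  have hsw := swap_dT hw1 hw2
  have hsw' : cst n A w = (dT A (Pi.single j 1))⁻¹ * (cst n A w * dT A (Pi.single m 1)) := by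
    rw [← hsw]; group
  conv_lhs => rw [hsw']
  group

lemma elem_subset_bruhatSet [IsLocalRing A] (hn : 3 ≤ Fintype.card n) {x : GL n A[T;T⁻¹]}
    (hx : x ∈ elem n A[T;T⁻¹]) : x ∈ bruhatSet n (IsLocalRing.residue A) := by
  have h := elem_le_affH hx
  clear hx
  induction h using Subgroup.closure_induction_left with
  | one => exact ⟨1, one_mem _, 0, 1, one_mem _, by simp⟩
  | mul_left x hx y _ ih =>
    obtain ⟨c, hc, rfl⟩ | ⟨j, rfl⟩ := hx
    · exact cst_mul_mem_bruhatSet hc ih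
    · exact dT_mul_mem_bruhatSet hn j ih
  | inv_mul_cancel x hx y _ ih =>
    obtain ⟨c, hc, rfl⟩ | ⟨j, rfl⟩ := hx
    · rw [← map_inv]
      exact cst_mul_mem_bruhatSet (inv_mem hc) ih
    · have := bruhatSet_contra (dT_mul_mem_bruhatSet hn j (bruhatSet_contra ih))
      rwa [map_mul, contra_contra, contra_dT] at this

lemma coeff_toLaurent_of_neg (f : A[X]) {m : ℤ} (hm : m < 0) :
    (Polynomial.toLaurent f).coeff m = 0 := by
  rw [← Finsupp.notMem_support_iff, LaurentPolynomial.support_coeff_toLaurent]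
  simp only [Finset.mem_map, not_exists, not_and]
  intro x _ h
  simp only [Nat.castEmbedding_apply] at h
  omega

lemma coeff_negL_of_pos (f : A[X]) {m : ℤ} (hm : 0 < m) : (negL A f).coeff m = 0 := by
  rw [negL_apply, LaurentPolynomial.invert_apply]
  exact coeff_toLaurent_of_neg _ (by omega)

lemma coeff_T_mul (f : A[T;T⁻¹]) (l m : ℤ) : (T l * f).coeff m = f.coeff (m - l) := by
  have := AddMonoidAlgebra.coeff_single_mul_eq_mul_coeff (R := A) (r := 1) (x := f) (m := l)
    (m₁ := m) (m - l) (fun m' _ => by omega)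
  rwa [one_mul] at this

lemma eq_zero_of_toLaurent_eq {f g : A[X]} {l : ℤ} (hl : l < 0)
    (h : Polynomial.toLaurent f = T l * negL A g) : f = 0 := by
  rw [← Polynomial.toLaurent_eq_zero]
  ext m
  by_cases hm : m < 0
  · rw [coeff_toLaurent_of_neg _ hm]; rfl
  · rw [h, coeff_T_mul, coeff_negL_of_pos _ (by omega)]; rfl

lemma eq_C_of_toLaurent_eq_negL {f g : A[X]} (h : Polynomial.toLaurent f = negL A g) :
    f = Polynomial.C (g.eval 0) := by
  rw [← sub_eq_zero]
  refine eq_zero_of_toLaurent_eq (l := -1) (g := g.divX) (by norm_num) ?_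
  conv_lhs => rw [map_sub, h, ← Polynomial.divX_mul_X_add g]
  rw [map_add, map_mul, negL_X, negL_C, Polynomial.toLaurent_C, mul_comm]
  simp [Polynomial.coeff_zero_eq_eval_zero]

lemma eq_zero_of_pos_eq [Nontrivial k] {z b : GL n k[X]} {l : n → ℤ}
    (h : pos n k z = dT k l * neg n k b) : l = 0 := by
  have key : ∀ {z b : GL n k[X]} {l : n → ℤ}, pos n k z = dT k l * neg n k b → ∀ r, 0 ≤ l r := by
    intro z b l h r
    by_contra! hr
    have hz : ∀ s, (z : Matrix n n k[X]) r s = 0 := by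
      intro s
      refine eq_zero_of_toLaurent_eq (g := (b : Matrix n n k[X]) r s) hr ?_
      have := congrArg (fun g : GL n k[T;T⁻¹] => (g : Matrix n n k[T;T⁻¹]) r s) h
      simp only [Units.val_mul, coe_dT, diagonal_mul] at this
      exact this
    have := congrFun (congrFun (Units.mul_inv z) r) r
    rw [Matrix.mul_apply, one_apply_eq] at this
    simp [hz] at this
  funext r
  refine le_antisymm ?_ (key h r)
  have h' := congrArg (contra n _) h
  rw [map_mul, contra_pos, contra_dT, contra_neg, ← dT_neg] at h'
  have := key h' r
  simpa using this

/-- Over a local ring, a polynomial matrix which is elementary over the Laurent polynomials is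
elementary over the polynomials. -/
lemma mem_elem_of_pos_mem_of_isLocalRing [IsLocalRing A] (hn : 3 ≤ Fintype.card n)
    {y : GL n A[X]} (hy : pos n A y ∈ elem n A[T;T⁻¹]) : y ∈ elem n A[X] := by
  obtain ⟨a, ha, l, e, he, eq⟩ := elem_subset_bruhatSet hn hy
  obtain ⟨ω, hω, b, hb, rfl⟩ := exists_of_mem_negK he
  have hl : l = 0 := by
    have := congrArg (redL n (IsLocalRing.residue A)) eq
    rw [map_mul, map_mul, map_mul, redL_pos, redL_pos, redL_dT, redL_neg, redL_eStar hω, one_mul,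
      mul_assoc, ← inv_mul_eq_iff_eq_mul, ← map_inv, ← map_mul] at this
    exact eq_zero_of_pos_eq this
  subst hl
  obtain ⟨a₁, ha₁, b₁, hb₁, -, -, rfl⟩ := eStar_subset_bigCell hn hω
  have hz : pos n A (a₁⁻¹ * a⁻¹ * y) = neg n A (b₁ * b) := by
    rw [map_mul, eq, map_mul, map_mul, map_inv, map_inv, dT_zero]
    group
  have hzc : a₁⁻¹ * a⁻¹ * y = cstP n A (ev0 n A (b₁ * b)) := by
    apply Units.ext
    ext1 r s
    exact eq_C_of_toLaurent_eq_negL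
      (congrArg (fun g : GL n A[T;T⁻¹] => (g : Matrix n n A[T;T⁻¹]) r s) hz)
  have : y = a * a₁ * cstP n A (ev0 n A (b₁ * b)) := by
    rw [← hzc]; group
  rw [this]
  exact mul_mem (mul_mem ha ha₁) (cstP_mem (ev0_mem (mul_mem hb₁ hb)))

end ElementaryGL

namespace ElementaryGL

variable {n : Type*} [Fintype n] [DecidableEq n]

open Polynomial (X C)
open scoped Polynomial LaurentPolynomial

section Dilation

variable {B B' : Type*} [CommRing B] [CommRing B'] (M : Submonoid B) (φ : B →+* B')

lemma exists_mem_forall {ι : Type*} [Finite ι] (p : ι → B → Prop)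
    (hp : ∀ i, ∃ s ∈ M, p i s) (hmul : ∀ i s t, p i s → p i (t * s)) :
    ∃ s ∈ M, ∀ i, p i s := by
  classical
  cases nonempty_fintype ι
  choose s hs h using hp
  refine ⟨∏ i, s i, prod_mem fun i _ => hs i, fun i => ?_⟩
  rw [← Finset.prod_erase_mul _ _ (Finset.mem_univ i)]
  exact hmul _ _ _ (h i)

/-- The ring homomorphism substituting `b X` for `X`. -/
noncomputable def scl (b : B) : B[X] →+* B[X] := Polynomial.eval₂RingHom C (C b * X)

@[simp] lemma scl_C (b a : B) : scl b (C a) = C a := by simp [scl]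

@[simp] lemma scl_X (b : B) : scl b X = C b * X := by simp [scl]

lemma scl_comp_scl (a b : B) : (scl a).comp (scl b) = scl (a * b) := by
  apply Polynomial.ringHom_ext
  · simp
  · simp only [RingHom.comp_apply, scl_X, map_mul, scl_C]; ring

lemma map_comp_scl (b : B) : (Polynomial.mapRingHom φ).comp (scl b) =
    (scl (φ b)).comp (Polynomial.mapRingHom φ) := by
  apply Polynomial.ringHom_ext <;> simp

lemma eval_comp_scl (b : B) : (Polynomial.evalRingHom 0).comp (scl b) =
    Polynomial.evalRingHom (0 : B) := by
  apply Polynomial.ringHom_ext <;> simp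

lemma scl_eq_zero {b : B} {f : B[X]} (h : C b * f = 0) (h0 : f.eval 0 = 0) : scl b f = 0 := by
  have hf : f = f.divX * X := by
    conv_lhs => rw [← Polynomial.divX_mul_X_add f, Polynomial.coeff_zero_eq_eval_zero, h0]
    simp
  have hd : C b * f.divX = 0 := by
    rw [← Polynomial.divX_C_mul, h, Polynomial.divX_zero]
  have : C b * scl b f.divX = 0 := by
    rw [← scl_C b b, ← map_mul, hd, map_zero]
  rw [hf, map_mul, scl_X, ← mul_assoc, mul_comm _ (C b), this, zero_mul]

variable {M φ}

lemma exists_map_eq_C_mul (h : ∀ x, ∃ s ∈ M, ∃ b, φ b = φ s * x) (f : B'[X]) :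
    ∃ s ∈ M, ∃ g : B[X], g.map φ = C (φ s) * f := by
  induction f using Polynomial.induction_on' with
  | add p q hp hq =>
    obtain ⟨s, hs, g, e⟩ := hp
    obtain ⟨t, ht, g', e'⟩ := hq
    refine ⟨s * t, mul_mem hs ht, C t * g + C s * g', ?_⟩
    simp only [Polynomial.map_add, Polynomial.map_mul, Polynomial.map_C, e, e', map_mul]
    ring
  | monomial m a =>
    obtain ⟨s, hs, b, e⟩ := h a
    exact ⟨s, hs, Polynomial.monomial m b, by simp [e, Polynomial.C_mul_monomial]⟩

lemma exists_C_mul_eq_zero (h : ∀ b, φ b = 0 → ∃ s ∈ M, s * b = 0) {f : B[X]} (hf : f.map φ = 0) :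
    ∃ s ∈ M, C s * f = 0 := by
  obtain ⟨s, hs, e⟩ := exists_mem_forall M (ι := f.support) (fun i s => s * f.coeff i = 0)
    (fun i => h _ (by rw [← Polynomial.coeff_map, hf, Polynomial.coeff_zero]))
    (fun i s t e => by rw [mul_assoc, e, mul_zero])
  refine ⟨s, hs, ?_⟩
  ext i
  rw [Polynomial.coeff_C_mul, Polynomial.coeff_zero]
  by_cases hi : i ∈ f.support
  · exact e ⟨i, hi⟩
  · rw [Polynomial.notMem_support_iff.1 hi, mul_zero]

lemma exists_elem_map_eq_scl (hn : 3 ≤ Fintype.card n) (h : ∀ x, ∃ s ∈ M, ∃ b, φ b = φ s * x)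
    {g : GL n B'[X]} (hg : g ∈ elem n B'[X]) (hg0 : ev0 n B' g = 1) :
    ∃ s ∈ M, ∃ η ∈ elem n B[X], ev0 n B η = 1 ∧
      GeneralLinearGroup.map (Polynomial.mapRingHom φ) η =
        GeneralLinearGroup.map (scl (φ s)) g := by
  refine elem_eval_zero_induction (p := fun g => ∃ s ∈ M, ∃ η ∈ elem n B[X], ev0 n B η = 1 ∧
      GeneralLinearGroup.map (Polynomial.mapRingHom φ) η =
        GeneralLinearGroup.map (scl (φ s)) g) ⟨1, one_mem _, 1, one_mem _, by simp, by simp⟩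
    ?_ ?_ hg hg0
  · rintro x y ⟨s, hs, η, hη, hη0, e⟩ ⟨t, ht, θ, hθ, hθ0, e'⟩
    refine ⟨t * s, mul_mem ht hs, GeneralLinearGroup.map (scl t) η *
      GeneralLinearGroup.map (scl s) θ, mul_mem (map_mem _ hη) (map_mem _ hθ), ?_, ?_⟩
    · rw [map_mul, ev0, map_map, map_map, eval_comp_scl, eval_comp_scl]
      change ev0 n B η * ev0 n B θ = 1
      rw [hη0, hθ0, one_mul]
    · rw [map_mul, map_mul, map_map, map_map, map_comp_scl, map_comp_scl, ← map_map, ← map_map,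
        e, e', map_map, map_map, scl_comp_scl, scl_comp_scl, ← map_mul φ, ← map_mul φ, mul_comm s t]
  · intro c hc i j hij f
    set v : n → B' := fun r => (c : Matrix n n B') r i
    set K : Matrix n n B' := vecMulVec (((c⁻¹ : GL n B') : Matrix n n B') j)
      (((c⁻¹ : GL n B') : Matrix n n B') i)
    obtain ⟨s, hs, hv⟩ := exists_mem_forall M (fun r s => ∃ b, φ b = φ s * v r) (fun r => h _)
      (fun r s t ⟨b, e⟩ => ⟨t * b, by rw [map_mul, e, map_mul, mul_assoc]⟩)
    obtain ⟨t, ht, hK⟩ := exists_mem_forall M (ι := n × n)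
      (fun r s => ∃ b, φ b = φ s * K r.1 r.2) (fun r => h _)
      (fun r s t ⟨b, e⟩ => ⟨t * b, by rw [map_mul, e, map_mul, mul_assoc]⟩)
    choose v' hv' using hv
    choose K' hK' using hK
    obtain ⟨u, hu, f', hf'⟩ := exists_map_eq_C_mul h f
    obtain ⟨w, hw⟩ : ∃ w, w = u * t * s * s := ⟨_, rfl⟩
    have hφw : φ w = φ u * φ t * φ s * φ s := by simp only [hw, map_mul]
    set v₀ : n → B[X] := fun r => C (v' r)
    set Q : Matrix n n B[X] := Matrix.of fun r r' => X * scl w f' * C (K' (r, r'))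
    obtain ⟨η, hη, eη⟩ := isElem_koszul hn v₀ Q
    have hent : ∀ r r', (η : Matrix n n B[X]) r r' = (1 : Matrix n n B[X]) r r' +
        v₀ r * ∑ k, (Q r' k - Q k r') * v₀ k := by
      intro r r'
      rw [eη, Matrix.add_apply, vecMulVec_apply]
      rfl
    refine ⟨w, hw ▸ mul_mem (mul_mem (mul_mem hu ht) hs) hs, η, hη, ?_, ?_⟩
    · apply Units.ext
      ext1 r r'
      change Polynomial.evalRingHom 0 ((η : Matrix n n B[X]) r r') = _
      rw [hent, map_add, map_mul, map_sum]
      simp [Q, Matrix.one_apply]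
    · apply Units.ext
      ext1 r r'
      change Polynomial.mapRingHom φ ((η : Matrix n n B[X]) r r') = scl (φ w)
        (((GeneralLinearGroup.map C c * trv i j hij (X * f) * (GeneralLinearGroup.map C c)⁻¹ :
          GL n B'[X]) : Matrix n n B'[X]) r r')
      have hscl : Polynomial.mapRingHom φ (scl w f') = C (φ u) * scl (φ w) f := by
        rw [← RingHom.comp_apply, map_comp_scl, RingHom.comp_apply, Polynomial.coe_mapRingHom, hf',
          map_mul, scl_C]
      have hc : ((GeneralLinearGroup.map C c * trv i j hij (X * f) *
          (GeneralLinearGroup.map C c)⁻¹ : GL n B'[X]) : Matrix n n B'[X]) r r' =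
            (1 : Matrix n n B'[X]) r r' +
          (X * f) * (C (v r) * ∑ k, (C (K r' k) - C (K k r')) * C (v k)) := by
        rw [coe_conj_trv, Matrix.add_apply, Matrix.smul_apply, vecMulVec_apply, ← map_inv]
        have hK : ∀ a b, C (K a b) = C ((((c⁻¹ : GL n B') : Matrix n n B') j) a) *
          C ((((c⁻¹ : GL n B') : Matrix n n B') i) b) := fun a b => by rw [← C.map_mul]; rfl
        simp only [hK]
        rfl
      rw [hc, hent, map_add, map_add, map_mul, map_mul, map_sum, map_mul, map_mul, map_sum]
      congr 1
      · simp [Matrix.one_apply, apply_ite (scl (φ w))]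
      · rw [Finset.mul_sum, Finset.mul_sum, Finset.mul_sum]
        refine Finset.sum_congr rfl fun k _ => ?_
        simp only [Q, v₀, Matrix.of_apply, map_mul, map_sub, hscl, scl_X, scl_C,
          Polynomial.coe_mapRingHom, Polynomial.map_C, Polynomial.map_X, hv', hK', hφw]
        ring

/-- A polynomial matrix that is trivial at zero and elementary over a localization becomes
elementary after a dilation of the variable. -/
lemma exists_scl_mem_elem (hn : 3 ≤ Fintype.card n) (h : ∀ x, ∃ s ∈ M, ∃ b, φ b = φ s * x)
    (h' : ∀ b, φ b = 0 → ∃ s ∈ M, s * b = 0) {g : GL n B[X]} (hg0 : ev0 n B g = 1)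
    (hg : GeneralLinearGroup.map (Polynomial.mapRingHom φ) g ∈ elem n B'[X]) :
    ∃ s ∈ M, GeneralLinearGroup.map (scl s) g ∈ elem n B[X] := by
  obtain ⟨s, hs, η, hη, hη0, e⟩ := exists_elem_map_eq_scl hn h hg (by
    change ev0 n B' (redP n φ g) = 1
    rw [ev0_redP, hg0, map_one])
  set δ := η⁻¹ * GeneralLinearGroup.map (scl s) g with hδ
  have hδ0 : ev0 n B δ = 1 := by
    rw [hδ, map_mul, map_inv, hη0, ev0, map_map, eval_comp_scl]
    change 1⁻¹ * ev0 n B g = 1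
    rw [hg0, inv_one, one_mul]
  have hδ1 : GeneralLinearGroup.map (Polynomial.mapRingHom φ) δ = 1 := by
    rw [hδ, map_mul, map_inv, e, map_map, map_map, map_comp_scl, inv_mul_cancel]
  obtain ⟨t, ht, hδt⟩ := exists_mem_forall M (ι := n × n)
    (fun r s => C s * (((δ : Matrix n n B[X]) - 1) r.1 r.2) = 0)
    (fun r => exists_C_mul_eq_zero h' (by
      have := congrArg (fun x : GL n B'[X] => (x : Matrix n n B'[X]) r.1 r.2) hδ1
      change Polynomial.mapRingHom φ _ = _ at this
      rw [← Polynomial.coe_mapRingHom, Matrix.sub_apply, map_sub, this]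
      simp [Matrix.one_apply]))
    (fun i s t e => by rw [map_mul, mul_assoc, e, mul_zero])
  have hδ2 : GeneralLinearGroup.map (scl t) δ = 1 := by
    apply Units.ext
    ext1 r r'
    have := scl_eq_zero (hδt (r, r')) (by
      have := congrArg (fun x : GL n B => (x : Matrix n n B) r r') hδ0
      change Polynomial.evalRingHom 0 _ = _ at this
      rw [← Polynomial.coe_evalRingHom, Matrix.sub_apply, map_sub, this]
      simp [Matrix.one_apply])
    rw [Matrix.sub_apply, map_sub, sub_eq_zero] at this
    change scl t _ = _
    rw [this]
    simp [Matrix.one_apply, apply_ite (scl t)]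
  refine ⟨t * s, mul_mem ht hs, ?_⟩
  have : GeneralLinearGroup.map (scl (t * s)) g = GeneralLinearGroup.map (scl t) η := by
    rw [← scl_comp_scl, ← map_map, ← mul_one (GeneralLinearGroup.map (scl t) η), ← hδ2, ← map_mul,
      hδ, mul_inv_cancel_left]
  rw [this]
  exact map_mem _ hη

end Dilation

end ElementaryGL

namespace ElementaryGL

variable {n : Type*} [Fintype n] [DecidableEq n]

open Polynomial (X C)
open scoped Polynomial LaurentPolynomial
open LaurentPolynomial (T)

section LocalGlobal

variable {R R' : Type*} [CommRing R'] [CommRing R]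

/-- The ring homomorphism `f(X) ↦ f(X + r Z)`, where `Z` is a new variable. -/
noncomputable def shift (r : R) : R[X] →+* R[X][X] :=
  Polynomial.eval₂RingHom (C.comp C) (C X + C (C r) * X)

@[simp] lemma shift_C (r a : R) : shift r (C a) = C (C a) := by simp [shift]

@[simp] lemma shift_X (r : R) : shift r X = C X + C (C r) * X := by simp [shift]

lemma shift_zero : shift (0 : R) = C := by
  apply Polynomial.ringHom_ext <;> simp

lemma scl_comp_shift (a r : R) : (scl (C a)).comp (shift r) = shift (a * r) := by
  apply Polynomial.ringHom_ext
  · simp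
  · simp; ring

lemma eval_comp_shift (r : R) : (Polynomial.evalRingHom 0).comp (shift r) = RingHom.id R[X] := by
  apply Polynomial.ringHom_ext <;> simp

lemma eval₂_comp_shift (r s : R) :
    (Polynomial.eval₂RingHom (shift r) X).comp (shift s) = shift (r + s) := by
  apply Polynomial.ringHom_ext
  · simp
  · simp; ring

lemma map_comp_shift (φ : R →+* R') (r : R) :
    (Polynomial.mapRingHom (Polynomial.mapRingHom φ)).comp (shift r) =
      (shift (φ r)).comp (Polynomial.mapRingHom φ) := by
  apply Polynomial.ringHom_ext <;> simp

lemma map_comp_C (φ : R →+* R') : (Polynomial.mapRingHom φ).comp C = C.comp φ := by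
  ext; simp

lemma scl_comp_C (b : R) : (scl b).comp C = C := by
  ext1; simp

/-- The matrix `y(X + r Z) y(X)⁻¹`. -/
noncomputable def shiftDiv (y : GL n R[X]) (r : R) : GL n R[X][X] :=
  GeneralLinearGroup.map (shift r) y * (GeneralLinearGroup.map C y)⁻¹

lemma map_scl_shiftDiv (y : GL n R[X]) (a r : R) :
    GeneralLinearGroup.map (scl (C a)) (shiftDiv y r) = shiftDiv y (a * r) := by
  rw [shiftDiv, map_mul, map_inv, map_map, map_map, scl_comp_shift, scl_comp_C, shiftDiv]

lemma shiftDiv_add (y : GL n R[X]) (r s : R) : shiftDiv y (r + s) =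
    GeneralLinearGroup.map (Polynomial.eval₂RingHom (shift r) X) (shiftDiv y s) *
      shiftDiv y r := by
  rw [shiftDiv, shiftDiv, map_mul, map_inv, map_map, map_map, eval₂_comp_shift,
    show (Polynomial.eval₂RingHom (shift r) X).comp C = shift r from
    RingHom.ext fun f => Polynomial.eval₂_C _ _, shiftDiv]
  group

/-- The ideal of dilations making `y(X + r Z) y(X)⁻¹` elementary. -/
noncomputable def shiftIdeal (y : GL n R[X]) : Ideal R where
  carrier := {r | shiftDiv y r ∈ elem n R[X][X]}
  zero_mem' := by
    rw [Set.mem_ofPred_eq, shiftDiv, shift_zero, mul_inv_cancel]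
    exact one_mem _
  add_mem' {r s} hr hs := by
    rw [Set.mem_ofPred_eq, shiftDiv_add]
    exact mul_mem (map_mem _ hs) hr
  smul_mem' a r hr := by
    rw [Set.mem_ofPred_eq, smul_eq_mul, ← map_scl_shiftDiv]
    exact map_mem _ hr

lemma mem_shiftIdeal {y : GL n R[X]} {r : R} :
    r ∈ shiftIdeal y ↔ shiftDiv y r ∈ elem n R[X][X] := Iff.rfl

lemma exists_notMem_mem_shiftIdeal (hn : 3 ≤ Fintype.card n) {y : GL n R[X]}
    (hy : pos n R y ∈ elem n R[T;T⁻¹]) (P : Ideal R) [P.IsPrime] :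
    ∃ r ∈ shiftIdeal y, r ∉ P := by
  set φ : R →+* Localization.AtPrime P := algebraMap _ _ with hφ
  have h : ∀ x, ∃ s ∈ P.primeCompl, ∃ b, φ b = φ s * x := by
    intro x
    obtain ⟨⟨b, s⟩, e⟩ := IsLocalization.surj P.primeCompl x
    exact ⟨s, s.2, b, by rw [mul_comm]; exact e.symm⟩
  have h' : ∀ b, φ b = 0 → ∃ s ∈ P.primeCompl, s * b = 0 := by
    intro b hb
    obtain ⟨s, e⟩ := (IsLocalization.map_eq_zero_iff P.primeCompl _ b).1 hb
    exact ⟨s, s.2, e⟩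
  have hyP : redP n φ y ∈ elem n (Localization.AtPrime P)[X] := by
    refine mem_elem_of_pos_mem_of_isLocalRing hn ?_
    rw [← redL_pos]
    exact map_mem _ hy
  obtain ⟨_, ⟨r, hr, rfl⟩, hτ⟩ := exists_scl_mem_elem (M := P.primeCompl.map (C : R →+* R[X]))
    (φ := Polynomial.mapRingHom φ) (g := shiftDiv y 1) hn (by
      intro f
      obtain ⟨s, hs, g, e⟩ := exists_map_eq_C_mul h f
      exact ⟨C s, Submonoid.mem_map_of_mem _ hs, g, by simpa using e⟩) (by
      intro f hf
      obtain ⟨s, hs, e⟩ := exists_C_mul_eq_zero h' hf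
      exact ⟨C s, Submonoid.mem_map_of_mem _ hs, e⟩) (by
      rw [shiftDiv, map_mul, map_inv, ev0, map_map, map_map, eval_comp_shift,
        show (Polynomial.evalRingHom (0 : R[X])).comp C = RingHom.id _ from
          RingHom.ext fun f => Polynomial.eval_C,
        mul_inv_cancel]) (by
      rw [shiftDiv, map_mul, map_inv, map_map, map_map, map_comp_shift, map_comp_C, ← map_map,
        ← map_map]
      exact mul_mem (map_mem _ hyP) (inv_mem (map_mem _ hyP)))
  refine ⟨r, ?_, hr⟩
  rw [mem_shiftIdeal]
  have := map_scl_shiftDiv y r 1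
  rw [mul_one] at this
  rw [← this]
  exact hτ

/-- A polynomial matrix which is elementary over the Laurent polynomials is, up to its constant
term, elementary over the polynomials. -/
lemma mul_inv_cstP_mem_elem (hn : 3 ≤ Fintype.card n) {y : GL n R[X]}
    (hy : pos n R y ∈ elem n R[T;T⁻¹]) : y * (cstP n R (ev0 n R y))⁻¹ ∈ elem n R[X] := by
  have htop : shiftIdeal y = ⊤ := by
    by_contra hne
    obtain ⟨P, hP, hle⟩ := Ideal.exists_le_maximal _ hne
    obtain ⟨r, hr, hrP⟩ := exists_notMem_mem_shiftIdeal hn hy P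
    exact hrP (hle hr)
  have h1 : shiftDiv y 1 ∈ elem n R[X][X] := by
    rw [← mem_shiftIdeal, htop]
    trivial
  have := map_mem (Polynomial.eval₂RingHom
    ((C : R →+* R[X]).comp (Polynomial.evalRingHom 0)) X) h1
  rw [shiftDiv, map_mul, map_inv, map_map, map_map] at this
  convert this using 2
  · rw [show (Polynomial.eval₂RingHom ((C : R →+* R[X]).comp (Polynomial.evalRingHom 0)) X).comp
      (shift 1) = RingHom.id R[X] by apply Polynomial.ringHom_ext <;> simp]
    rfl
  · rw [show (Polynomial.eval₂RingHom ((C : R →+* R[X]).comp (Polynomial.evalRingHom 0)) X).comp C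
      = (C : R →+* R[X]).comp (Polynomial.evalRingHom 0) from RingHom.ext fun f => Polynomial.eval₂_C _ _]
    rfl

lemma ev0_mem_elem (hn : 3 ≤ Fintype.card n) {y : GL n R[X]}
    (hy : pos n R y ∈ elem n R[T;T⁻¹]) : ev0 n R y ∈ elem n R := by
  have h1 := map_mem (LaurentPolynomial.eval₂ (RingHom.id R) 1) hy
  rw [pos, map_map] at h1
  have h2 := map_mem (Polynomial.evalRingHom (1 : R)) (mul_inv_cstP_mem_elem hn hy)
  rw [map_mul, map_inv, cstP, map_map, show (Polynomial.evalRingHom (1 : R)).comp C =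
    RingHom.id R by ext1; simp, show Polynomial.evalRingHom (1 : R) =
    (LaurentPolynomial.eval₂ (RingHom.id R) 1).comp Polynomial.toLaurent by
      apply Polynomial.ringHom_ext <;> simp] at h2
  have := (Subgroup.mul_mem_cancel_left _ h1).1 h2
  exact inv_mem_iff.1 this

lemma mem_elem_of_pos_mem (hn : 3 ≤ Fintype.card n) {y : GL n R[X]}
    (hy : pos n R y ∈ elem n R[T;T⁻¹]) : y ∈ elem n R[X] := by
  have := mul_mem (mul_inv_cstP_mem_elem hn hy) (cstP_mem (ev0_mem_elem hn hy))
  rwa [inv_mul_cancel_right] at this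

end LocalGlobal

end ElementaryGL

namespace ElementaryGL

variable {n : Type*} [Fintype n] [DecidableEq n]

section LocalHom

variable {S S' : Type*} [CommRing S'] [CommRing S]

lemma transvection_mulVec_apply (i j : n) (a : S) (x : n → S) (r : n) :
    (transvection i j a *ᵥ x) r = x r + if r = i then a * x j else 0 := by
  rw [transvection, add_mulVec, one_mulVec, single_mulVec]
  simp [Function.update_apply]

lemma exists_elem_mul_mulVec_single (q : S →+* S') [IsLocalHom q] {h : GL n S}
    (hq : GeneralLinearGroup.map q h = 1) {k l : n} (hkl : k ≠ l) :
    ∃ e ∈ elem n S, GeneralLinearGroup.map q e = 1 ∧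
      ((e * h : GL n S) : Matrix n n S) *ᵥ Pi.single k 1 = Pi.single k 1 ∧
      ∀ j, j ≠ k → j ≠ l → (e : Matrix n n S) *ᵥ Pi.single j 1 = Pi.single j 1 := by
  set x : n → S := (h : Matrix n n S) *ᵥ Pi.single k 1 with hx
  have hqx : ∀ r, q (x r) = if r = k then 1 else 0 := by
    intro r
    have := congrArg (fun g : GL n S' => (g : Matrix n n S') r k) hq
    change q ((h : Matrix n n S) r k) = (1 : Matrix n n S') r k at this
    rw [hx, mulVec_single_one, col_apply, this, one_apply]
  have hu : IsUnit (x l + x k) := by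
    apply isUnit_of_map_unit q
    rw [map_add, hqx, hqx, if_neg hkl.symm, if_pos rfl, zero_add]
    exact isUnit_one
  obtain ⟨u, hu⟩ := hu
  set c : S := (1 - x k) * (u⁻¹ : Sˣ) with hc
  have hqc : q c = 0 := by rw [hc, map_mul, map_sub, hqx, if_pos rfl, map_one, sub_self, zero_mul]
  set z : n → S := transvection k l c *ᵥ (transvection l k 1 *ᵥ x) with hz
  have hzr : ∀ r, z r = x r + (if r = l then x k else 0) + if r = k then 1 - x k else 0 := by
    intro r
    rw [hz, transvection_mulVec_apply, transvection_mulVec_apply, transvection_mulVec_apply,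
      if_pos rfl, one_mul, ← hu, hc, mul_assoc, Units.inv_mul, mul_one]
  have hzk : z k = 1 := by
    rw [hzr, if_neg hkl, if_pos rfl]; ring
  obtain ⟨e, he, ee⟩ := isElem_one_add_vecMulVec_single k (Pi.single k 1 - z) (by simp [hzk])
  refine ⟨e * trv k l hkl c * trv l k hkl.symm 1, mul_mem (mul_mem he (trv_mem _ _ _ _))
    (trv_mem _ _ _ _), ?_, ?_, ?_⟩
  · have : GeneralLinearGroup.map q e = trv l k hkl.symm (-1) := by
      apply Units.ext
      ext1 r s
      change q ((e : Matrix n n S) r s) = _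
      rw [ee, coe_trv, transvection, Matrix.add_apply, Matrix.add_apply, vecMulVec_apply,
        Matrix.single_apply, Pi.sub_apply, hzr, map_add, map_mul, map_sub]
      simp only [map_add, hqx, apply_ite q, map_zero, map_sub, map_one, Matrix.one_apply,
        Pi.single_apply]
      by_cases hrk : r = k
      · subst hrk; simp [hkl, hkl.symm]
      · by_cases hrl : r = l
        · subst hrl
          by_cases hs : s = k
          · subst hs; simp [hkl.symm]
          · simp [hs, Ne.symm hs, hrk]
        · simp [hrk, hrl, Ne.symm hrl]
    rw [map_mul, map_mul, this, map_trv, map_trv, hqc, map_one, trv_neg,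
      show trv k l hkl (0 : S') = 1 by apply Units.ext; simp, mul_one, inv_mul_cancel]
  · rw [Units.val_mul, Units.val_mul, Units.val_mul, ← mulVec_mulVec, ← mulVec_mulVec,
      ← mulVec_mulVec, coe_trv, coe_trv, ← hx, ← hz, ee, add_mulVec, one_mulVec, vecMulVec_mulVec]
    simp [hzk]
  · intro j hjk hjl
    rw [Units.val_mul, Units.val_mul, ← mulVec_mulVec, ← mulVec_mulVec, coe_trv, coe_trv]
    have h1 : transvection l k (1 : S) *ᵥ Pi.single j 1 = Pi.single j 1 := by
      ext r; simp [transvection_mulVec_apply, hjk.symm]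
    have h2 : transvection k l c *ᵥ Pi.single j 1 = Pi.single j 1 := by
      ext r; simp [transvection_mulVec_apply, hjl.symm]
    rw [h1, h2, ee, add_mulVec, one_mulVec, vecMulVec_mulVec]
    simp [hjk.symm]

/-- A matrix of determinant one which is congruent to one modulo an ideal in the Jacobson radical is
elementary. -/
lemma mem_elem_of_map_eq_one (q : S →+* S') [IsLocalHom q] {h : GL n S}
    (hq : GeneralLinearGroup.map q h = 1) (hdet : (h : Matrix n n S).det = 1) :
    h ∈ elem n S := by
  cases isEmpty_or_nonempty n with
  | inl _ =>
    rw [show h = 1 from Units.ext (Subsingleton.elim _ _)]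
    exact one_mem _
  | inr hne =>
  obtain ⟨l⟩ := hne
  have key : ∀ s : Finset n, l ∉ s → ∃ e ∈ elem n S, GeneralLinearGroup.map q e = 1 ∧
      ∀ j ∈ s, ((e * h : GL n S) : Matrix n n S) *ᵥ Pi.single j 1 = Pi.single j 1 := by
    intro s
    induction s using Finset.induction_on with
    | empty => exact fun _ => ⟨1, one_mem _, map_one _, by simp⟩
    | insert k s hk ih =>
      intro hl
      simp only [Finset.mem_insert, not_or] at hl
      obtain ⟨e, he, heq, hes⟩ := ih hl.2
      obtain ⟨e', he', heq', hek, hej⟩ := exists_elem_mul_mulVec_single q (h := e * h)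
        (by rw [map_mul, heq, hq, one_mul]) (Ne.symm hl.1)
      refine ⟨e' * e, mul_mem he' he, by rw [map_mul, heq, heq', one_mul], ?_⟩
      intro j hj
      rw [mul_assoc]
      rcases Finset.mem_insert.1 hj with rfl | hj
      · exact hek
      · rw [Units.val_mul, ← mulVec_mulVec, hes j hj]
        exact hej j (fun h => hk (h ▸ hj)) (fun h => hl.2 (h ▸ hj))
  obtain ⟨e, he, -, hes⟩ := key (Finset.univ.erase l) (by simp)
  obtain ⟨g, hg⟩ : ∃ g, g = e * h := ⟨_, rfl⟩
  rw [← hg] at hes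
  have hgdet : (g : Matrix n n S).det = 1 := by
    rw [hg, Units.val_mul, det_mul, det_eq_one he, hdet, one_mul]
  have hcol : ∀ r s, s ≠ l → (g : Matrix n n S) r s = (1 : Matrix n n S) r s := by
    intro r s hs
    have := congrFun (hes s (by simp [hs])) r
    rw [mulVec_single_one, col_apply] at this
    rw [this, Matrix.one_apply, Pi.single_apply]
  have hll : (g : Matrix n n S) l l = 1 := by
    have h1 : (g : Matrix n n S) =
        (1 : Matrix n n S).updateCol l fun r => (g : Matrix n n S) r l := by
      ext r s
      by_cases hs : s = l
      · subst hs; simp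
      · rw [hcol r s hs, updateCol_ne hs]
    rw [h1, ← cramer_apply, cramer_one] at hgdet
    exact hgdet
  have hge : IsElem (g : Matrix n n S) := by
    convert isElem_one_add_vecMulVec_single l (fun r => (g : Matrix n n S) r l - if r = l then 1 else 0)
      (by simp [hll]) using 1
    ext r s
    rw [Matrix.add_apply, vecMulVec_apply]
    by_cases hs : s = l
    · subst hs; simp [Matrix.one_apply]
    · rw [hcol r s hs, Pi.single_eq_of_ne hs, mul_zero, add_zero]
  rw [show h = e⁻¹ * g by rw [hg]; group]
  exact mul_mem (inv_mem he) (isElem_coe.1 hge)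

end LocalHom

end ElementaryGL

namespace ElementaryGL

variable {n : Type*} [Fintype n] [DecidableEq n]

open scoped Polynomial LaurentPolynomial
open LaurentPolynomial (T)

section Density

variable {R : Type*} [CommRing R]

lemma exists_map_eq_of_range {S S' : Type*} [CommRing S] [CommRing S'] {f : S →+* S'}
    (hf : Function.Injective f) {x : GL n S'} (hx : ∀ r s, (x : Matrix n n S') r s ∈ f.range)
    (hx' : ∀ r s, ((x⁻¹ : GL n S') : Matrix n n S') r s ∈ f.range) :
    ∃ y : GL n S, GeneralLinearGroup.map f y = x := by
  choose y hy using hx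
  choose z hz using hx'
  have hy' : (Matrix.of y).map f = x := by ext r s; exact hy r s
  have hz' : (Matrix.of z).map f = ((x⁻¹ : GL n S') : Matrix n n S') := by ext r s; exact hz r s
  refine ⟨⟨Matrix.of y, Matrix.of z, ?_, ?_⟩, Units.ext hy'⟩
  · apply Matrix.map_injective hf
    simp only [Matrix.map_mul, hy', hz', Units.mul_inv, Matrix.map_one _ f.map_zero f.map_one]
  · apply Matrix.map_injective hf
    simp only [Matrix.map_mul, hy', hz', Units.inv_mul, Matrix.map_one _ f.map_zero f.map_one]

instance : IsLocalHom (PowerSeries.constantCoeff (R := R)) :=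
  ⟨fun _ h => PowerSeries.isUnit_iff_constantCoeff.2 h⟩

/-- The variable as a unit of the ring of Laurent series. -/
noncomputable def tauS (R : Type*) [CommRing R] : (LaurentSeries R)ˣ :=
  ⟨HahnSeries.single 1 1, HahnSeries.single (-1) 1, by simp [HahnSeries.single_mul_single],
    by simp [HahnSeries.single_mul_single]⟩

lemma coe_tauS : (tauS R : LaurentSeries R) = HahnSeries.ofPowerSeries ℤ R PowerSeries.X := by
  rw [HahnSeries.ofPowerSeries_X]; rfl

/-- Laurent polynomials as Laurent series. -/
noncomputable def toSeries (R : Type*) [CommRing R] : R[T;T⁻¹] →+* LaurentSeries R :=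
  LaurentPolynomial.eval₂ ((HahnSeries.ofPowerSeries ℤ R).comp PowerSeries.C) (tauS R)

lemma toSeries_T (m : ℤ) : toSeries R (T m) = ((tauS R ^ m : (LaurentSeries R)ˣ) : _) := by
  rw [toSeries, LaurentPolynomial.eval₂_T]

lemma toSeries_comp_toLaurent : (toSeries R).comp Polynomial.toLaurent =
    (HahnSeries.ofPowerSeries ℤ R).comp Polynomial.coeToPowerSeries.ringHom := by
  apply Polynomial.ringHom_ext
  · intro a
    simp [toSeries]
  · simp [toSeries, coe_tauS]

lemma toSeries_toLaurent (f : R[X]) : toSeries R (Polynomial.toLaurent f) =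
    HahnSeries.ofPowerSeries ℤ R (f : PowerSeries R) :=
  RingHom.congr_fun toSeries_comp_toLaurent f

lemma mem_range_toLaurent {f : R[T;T⁻¹]} {g : PowerSeries R}
    (h : toSeries R f = HahnSeries.ofPowerSeries ℤ R g) :
    f ∈ (Polynomial.toLaurent : R[X] →+* R[T;T⁻¹]).range := by
  obtain ⟨m, p, hp⟩ := LaurentPolynomial.exists_T_pow f
  have hpg : (p : PowerSeries R) = g * PowerSeries.X ^ m := by
    apply HahnSeries.ofPowerSeries_injective (Γ := ℤ)
    rw [← toSeries_toLaurent, hp, map_mul, map_mul, h, map_pow, toSeries_T, zpow_natCast,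
      Units.val_pow_eq_pow_val, coe_tauS]
  have : (Polynomial.X : R[X]) ^ m ∣ p := by
    rw [Polynomial.X_pow_dvd_iff]
    intro d hd
    rw [← Polynomial.coeff_coe]
    exact PowerSeries.X_pow_dvd_iff.1 ⟨g, by rw [hpg, mul_comm]⟩ d hd
  obtain ⟨p', rfl⟩ := this
  refine ⟨p', ?_⟩
  rw [map_mul, map_pow, Polynomial.toLaurent_X, LaurentPolynomial.T_pow, mul_one, mul_comm] at hp
  have := congrArg (· * T (-(m : ℤ))) hp
  simpa only [mul_assoc, ← LaurentPolynomial.T_add, add_neg_cancel, LaurentPolynomial.T_zero,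
    mul_one] using this

lemma exists_eq_toSeries_add (a : LaurentSeries R) (N : ℕ) : ∃ (b : R[T;T⁻¹]) (c : PowerSeries R),
    a = toSeries R b + toSeries R (T N) * HahnSeries.ofPowerSeries ℤ R c := by
  obtain ⟨⟨p, _, ⟨m, rfl⟩⟩, e⟩ :=
    IsLocalization.surj (Submonoid.powers (PowerSeries.X : PowerSeries R)) a
  simp only [LaurentSeries.coe_algebraMap] at e
  rw [map_pow, ← coe_tauS, ← Units.val_pow_eq_pow_val, ← zpow_natCast, ← toSeries_T] at e
  refine ⟨T (-(m : ℤ)) * Polynomial.toLaurent (p.trunc (N + m)),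
    PowerSeries.mk fun i => p.coeff (i + (N + m)), ?_⟩
  have ha : a = toSeries R (T (-(m : ℤ))) * HahnSeries.ofPowerSeries ℤ R p := by
    rw [← e, mul_left_comm, ← map_mul, ← LaurentPolynomial.T_add, neg_add_cancel,
      LaurentPolynomial.T_zero, map_one, mul_one]
  rw [ha]
  conv_lhs => rw [PowerSeries.eq_X_pow_mul_shift_add_trunc (N + m) p]
  rw [map_add, map_mul (HahnSeries.ofPowerSeries ℤ R), map_pow, ← coe_tauS,
    ← Units.val_pow_eq_pow_val, ← zpow_natCast, ← toSeries_T, map_mul (toSeries R),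
    toSeries_toLaurent, mul_add, ← mul_assoc, ← map_mul, ← LaurentPolynomial.T_add, add_comm]
  congr 4
  push_cast
  ring

lemma exists_toLaurent_eq_T_mul {ι : Type*} [Fintype ι] (f : ι → R[T;T⁻¹]) :
    ∃ N : ℕ, ∀ i, ∃ p : R[X], Polynomial.toLaurent p = T N * f i := by
  choose m p hp using fun i => LaurentPolynomial.exists_T_pow (f i)
  refine ⟨∑ i, m i, fun i => ⟨Polynomial.X ^ (∑ i, m i - m i) * p i, ?_⟩⟩
  have hle : m i ≤ ∑ i, m i := Finset.single_le_sum (fun _ _ => Nat.zero_le _) (Finset.mem_univ i)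
  rw [map_mul, hp, map_pow, Polynomial.toLaurent_X, LaurentPolynomial.T_pow, mul_comm (f i),
    ← mul_assoc, ← LaurentPolynomial.T_add, mul_one]
  congr 2
  omega

lemma exists_eq_one_add_X_smul (K : Matrix n n (PowerSeries R)) : ∃ h : GL n (PowerSeries R),
    (h : Matrix n n (PowerSeries R)) = 1 + (PowerSeries.X : PowerSeries R) • K ∧
      GeneralLinearGroup.map (PowerSeries.constantCoeff (R := R)) h = 1 := by
  have h1 : (1 + (PowerSeries.X : PowerSeries R) • K).map (PowerSeries.constantCoeff (R := R)) =
      1 := by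
    ext1 r s
    simp [Matrix.one_apply, apply_ite (PowerSeries.constantCoeff (R := R))]
  have hdet : IsUnit (1 + (PowerSeries.X : PowerSeries R) • K).det := by
    apply isUnit_of_map_unit (PowerSeries.constantCoeff (R := R))
    rw [RingHom.map_det, RingHom.mapMatrix_apply, h1, det_one]
    exact isUnit_one
  exact ⟨GeneralLinearGroup.mk'' _ hdet, rfl, Units.ext h1⟩

/-- An elementary matrix over the Laurent series is a product of an elementary matrix over the
Laurent polynomials and a matrix over the power series which is congruent to one. -/
lemma exists_eq_toSeries_mul {x : GL n (LaurentSeries R)} (hx : x ∈ elem n (LaurentSeries R)) :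
    ∃ z ∈ elem n R[T;T⁻¹], ∃ h : GL n (PowerSeries R),
      GeneralLinearGroup.map (PowerSeries.constantCoeff (R := R)) h = 1 ∧
      x = GeneralLinearGroup.map (toSeries R) z *
        GeneralLinearGroup.map (HahnSeries.ofPowerSeries ℤ R) h := by
  refine elem_induction (p := fun x => ∃ z ∈ elem n R[T;T⁻¹], ∃ h : GL n (PowerSeries R),
      GeneralLinearGroup.map (PowerSeries.constantCoeff (R := R)) h = 1 ∧
      x = GeneralLinearGroup.map (toSeries R) z *
        GeneralLinearGroup.map (HahnSeries.ofPowerSeries ℤ R) h)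
    ⟨1, one_mem _, 1, map_one _, by simp⟩ ?_ hx
  rintro i j hij a _ - ⟨z, hz, h, hh, rfl⟩
  obtain ⟨N, hN⟩ := exists_toLaurent_eq_T_mul fun r : n × n =>
    ((z⁻¹ : GL n R[T;T⁻¹]) : Matrix n n R[T;T⁻¹]) r.1 i * (z : Matrix n n R[T;T⁻¹]) j r.2
  choose p hp using hN
  obtain ⟨b, c, rfl⟩ := exists_eq_toSeries_add a (N + 1)
  obtain ⟨h', eh', hh'⟩ := exists_eq_one_add_X_smul
    (Matrix.of fun r s => c * (p (r, s) : PowerSeries R))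
  refine ⟨trv i j hij b * z, mul_mem (trv_mem _ _ _ _) hz, h' * h, by rw [map_mul, hh, hh', one_mul],
    ?_⟩
  have key : (GeneralLinearGroup.map (toSeries R) z)⁻¹ * trv i j hij
      (toSeries R (T ((N + 1 : ℕ) : ℤ)) * HahnSeries.ofPowerSeries ℤ R c) *
      GeneralLinearGroup.map (toSeries R) z =
      GeneralLinearGroup.map (HahnSeries.ofPowerSeries ℤ R) h' := by
    apply Units.ext
    rw [← map_inv]
    have := coe_conj_trv_eq_one_add_smul (GeneralLinearGroup.map (toSeries R) z⁻¹) i j hij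
      (toSeries R (T ((N + 1 : ℕ) : ℤ)) * HahnSeries.ofPowerSeries ℤ R c)
    rw [← map_inv, inv_inv] at this
    rw [this]
    ext1 r s
    change _ = HahnSeries.ofPowerSeries ℤ R ((h' : Matrix n n (PowerSeries R)) r s)
    rw [eh', Matrix.add_apply, Matrix.smul_apply, Matrix.add_apply, Matrix.smul_apply,
      vecMulVec_apply, Matrix.of_apply, map_add, smul_eq_mul, smul_eq_mul, map_mul, map_mul,
      ← toSeries_toLaurent, hp]
    congr 1
    · simp [Matrix.one_apply, apply_ite (HahnSeries.ofPowerSeries ℤ R)]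
    · change _ * (toSeries R (((z⁻¹ : GL n R[T;T⁻¹]) : Matrix n n R[T;T⁻¹]) r i) *
        toSeries R ((z : Matrix n n R[T;T⁻¹]) j s)) = _
      have hT : toSeries R (T ((N + 1 : ℕ) : ℤ)) = toSeries R (T N) *
          HahnSeries.ofPowerSeries ℤ R PowerSeries.X := by
        rw [toSeries_T, toSeries_T, ← coe_tauS, zpow_natCast, zpow_natCast, pow_succ, Units.val_mul]
      rw [hT, map_mul, map_mul]
      ring
  rw [trv_add, map_mul, map_mul, map_trv, ← key]
  group

/-- A matrix over the power series which becomes elementary over the Laurent series is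
elementary. -/
lemma mem_elem_of_map_ofPowerSeries_mem (hn : 3 ≤ Fintype.card n) {g : GL n (PowerSeries R)}
    (hg : GeneralLinearGroup.map (HahnSeries.ofPowerSeries ℤ R) g ∈ elem n (LaurentSeries R)) :
    g ∈ elem n (PowerSeries R) := by
  obtain ⟨z, hz, h, hh, e⟩ := exists_eq_toSeries_mul hg
  have ez : GeneralLinearGroup.map (toSeries R) z =
      GeneralLinearGroup.map (HahnSeries.ofPowerSeries ℤ R) (g * h⁻¹) := by
    rw [map_mul, e, map_inv, mul_inv_cancel_right]
  obtain ⟨y, rfl⟩ : ∃ y, pos n R y = z := by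
    refine exists_map_eq_of_range Polynomial.toLaurent_injective (fun r s => ?_) fun r s => ?_
    · exact mem_range_toLaurent
        (congrArg (fun x : GL n (LaurentSeries R) => (x : Matrix n n (LaurentSeries R)) r s) ez)
    · have ez' := congrArg (·⁻¹) ez
      simp only [← map_inv] at ez'
      exact mem_range_toLaurent
        (congrArg (fun x : GL n (LaurentSeries R) => (x : Matrix n n (LaurentSeries R)) r s) ez')
  have hy := map_mem (Polynomial.coeToPowerSeries.ringHom (R := R)) (mem_elem_of_pos_mem hn hz)
  have ey : GeneralLinearGroup.map (Polynomial.coeToPowerSeries.ringHom (R := R)) y = g * h⁻¹ := by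
    apply map_injective (HahnSeries.ofPowerSeries_injective (Γ := ℤ))
    rw [← ez, pos, map_map, map_map, toSeries_comp_toLaurent]
  rw [ey] at hy
  have hgdet : (g : Matrix n n (PowerSeries R)).det = 1 := by
    have := det_eq_one hg
    apply HahnSeries.ofPowerSeries_injective (Γ := ℤ)
    rw [RingHom.map_det, map_one]
    exact this
  have hhdet : (h : Matrix n n (PowerSeries R)).det = 1 := by
    rw [← hgdet, ← inv_mul_cancel_right g h, Units.val_mul, det_mul, det_eq_one hy, one_mul]
  have := mul_mem hy (mem_elem_of_map_eq_one (PowerSeries.constantCoeff (R := R)) hh hhdet)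
  rwa [inv_mul_cancel_right] at this

end Density

lemma toGL_mem_elem_iff {m : ℕ} {S : Type*} [CommRing S] (g : SpecialLinearGroup (Fin m) S) :
    SpecialLinearGroup.toGL g ∈ elem (Fin m) S ↔ g ∈ ElemSubgroup m S := by
  constructor
  · intro h
    have hle : elem (Fin m) S ≤ (ElemSubgroup m S).map SpecialLinearGroup.toGL := by
      rw [elem, Subgroup.closure_le]
      rintro x ⟨i, j, a, hij, e⟩
      exact ⟨⟨transvection i j a, det_transvection_of_ne _ _ hij _⟩,
        Subgroup.subset_closure ⟨i, j, a, hij, rfl⟩, Units.ext e.symm⟩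
    obtain ⟨x, hx, e⟩ := hle h
    rwa [← SpecialLinearGroup.toGL_injective e]
  · have hle : ElemSubgroup m S ≤ (elem (Fin m) S).comap SpecialLinearGroup.toGL := by
      rw [ElemSubgroup, Subgroup.closure_le]
      rintro x ⟨i, j, a, hij, e⟩
      exact Subgroup.subset_closure ⟨i, j, a, hij, e⟩
    exact fun h => hle h

end ElementaryGL

/-- The natural map `K1^{SL_m}(R[[t]]) → K1^{SL_m}(R((t)))` is injective for `m ≥ 3`:
if `g ∈ SL_m(R[[t]])` becomes elementary over `R((t))`, it is elementary over `R[[t]]`. -/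
theorem k1_powerSeries_to_laurentSeries_injective (R : Type*) [CommRing R] (m : ℕ)
    (hm : 3 ≤ m) (g : SpecialLinearGroup (Fin m) (PowerSeries R))
    (h : SpecialLinearGroup.map (HahnSeries.ofPowerSeries ℤ R) g
        ∈ ElemSubgroup m (LaurentSeries R)) :
    g ∈ ElemSubgroup m (PowerSeries R) := by
  rw [← ElementaryGL.toGL_mem_elem_iff] at h ⊢
  refine ElementaryGL.mem_elem_of_map_ofPowerSeries_mem (by simpa using hm) ?_
  convert h using 1
  exact Units.ext rfl
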